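/- arXiv:1707.01200 — 4 statements merged into one kernel-verified Lean document; each statement's English description precedes it below -/
import Mathlib

section
/- For n ≥ 2k ≥ 2 and i ≥ 1, the generating function of the major index over standard Young tableaux of shape (n-k,k) with exactly i descents equals q^{k+i²-i} (1-q^{n-2k+1})/(1-q^i) · [k-1 choose i-1]_q · [n-k choose i-1]_q. -/
open Finset Polynomial
open scoped Classical

/-- A standard Young tableau of two-rowed shape `(n-b, b)` is encoded by the set `S`
of entries of its second row: `S ⊆ {1,…,n}`, `|S| = b`, and for every `m` at most
half of `{1,…,m}` lies in `S` (the ballot condition, which makes columns increase). -/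
noncomputable def sytSet (n b : ℕ) : Finset (Finset ℕ) :=
  (Finset.Icc 1 n).powerset.filter
    (fun S => S.card = b ∧ ∀ m ∈ Finset.Icc 1 n, 2 * (S ∩ Finset.Icc 1 m).card ≤ m)

/-- The descent set of a two-rowed SYT with second row `S`: those `i` with `i+1`
in the second row and `i` in the first row (i.e. `i+1` strictly lower than `i`). -/
def tabDes (n : ℕ) (S : Finset ℕ) : Finset ℕ :=
  (Finset.Icc 1 n).filter (fun i => i + 1 ∈ S ∧ i ∉ S)

/-- The major index of a two-rowed SYT: the sum of its descents. -/
def tabMaj (n : ℕ) (S : Finset ℕ) : ℕ := (tabDes n S).sum id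

/-- `sytMajGF a b i` is the generating function `∑ q^{maj T}` over standard Young
tableaux `T` of shape `(a, b)` with exactly `i` descents. -/
noncomputable def sytMajGF (a b i : ℕ) : Polynomial ℚ :=
  (((sytSet (a + b) b).filter (fun S => (tabDes (a + b) S).card = i)).sum
    (fun S => Polynomial.X ^ (tabMaj (a + b) S)))

/-- The q-Pochhammer `(q)_N = (1-q)(1-q^2)⋯(1-q^N)` as a rational function in `q`. -/
noncomputable def qPoch (N : ℕ) : RatFunc ℚ :=
  ∏ j ∈ Finset.range N, (1 - RatFunc.X ^ (j + 1))

/-- The Gaussian binomial coefficient `[M choose N]_q = (q)_M / ((q)_N (q)_{M-N})`,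
with the convention that it is `0` when `N > M`. -/
noncomputable def gaussBinom (M N : ℕ) : RatFunc ℚ :=
  if N ≤ M then qPoch M / (qPoch N * qPoch (M - N)) else 0

lemma tabDes_succ {n : ℕ} {S : Finset ℕ} (h : S ⊆ Finset.Icc 1 (n+1)) :
    tabDes (n+1) S = tabDes n S := by
  ext j
  simp only [tabDes, Finset.mem_filter, Finset.mem_Icc]
  constructor
  · rintro ⟨⟨h1, h2⟩, h3, h4⟩
    have := Finset.mem_Icc.1 (h h3)
    exact ⟨⟨h1, by omega⟩, h3, h4⟩
  · rintro ⟨⟨h1, h2⟩, h3, h4⟩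
    exact ⟨⟨h1, by omega⟩, h3, h4⟩

lemma tabDes_insert {n : ℕ} {T : Finset ℕ} (h : T ⊆ Finset.Icc 1 (n+1)) (hm : n+1 ∈ T) :
    tabDes (n+2) (insert (n+2) T) = tabDes (n+1) T := by
  ext j
  simp only [tabDes, Finset.mem_filter, Finset.mem_Icc, Finset.mem_insert]
  constructor
  · rintro ⟨⟨h1, h2⟩, h3, h4⟩
    push Not at h4
    rcases h3 with h3 | h3
    · have : j = n + 1 := by omega
      subst this
      exact absurd hm h4.2
    · have := Finset.mem_Icc.1 (h h3)
      exact ⟨⟨h1, by omega⟩, h3, h4.2⟩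
  · rintro ⟨⟨h1, h2⟩, h3, h4⟩
    refine ⟨⟨h1, by omega⟩, Or.inr h3, ?_⟩
    rintro (h5 | h5)
    · omega
    · exact h4 h5

lemma tabDes_insert2 {n : ℕ} {T : Finset ℕ} (h : T ⊆ Finset.Icc 1 n) :
    tabDes (n+2) (insert (n+2) T) = insert (n+1) (tabDes n T) := by
  ext j
  simp only [tabDes, Finset.mem_filter, Finset.mem_Icc, Finset.mem_insert]
  constructor
  · rintro ⟨⟨h1, h2⟩, h3, h4⟩
    push Not at h4
    rcases h3 with h3 | h3
    · left; omega
    · right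
      have := Finset.mem_Icc.1 (h h3)
      exact ⟨⟨h1, by omega⟩, h3, h4.2⟩
  · rintro (h1 | ⟨⟨h1, h2⟩, h3, h4⟩)
    · subst h1
      refine ⟨⟨by omega, by omega⟩, Or.inl rfl, ?_⟩
      rintro (h5 | h5)
      · omega
      · have := Finset.mem_Icc.1 (h h5)
        omega
    · refine ⟨⟨h1, by omega⟩, Or.inr h3, ?_⟩
      rintro (h5 | h5)
      · omega
      · exact h4 h5

lemma not_mem_tabDes {n m : ℕ} {T : Finset ℕ} (h : n < m) : m ∉ tabDes n T := by
  simp only [tabDes, Finset.mem_filter, Finset.mem_Icc]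
  omega

noncomputable def setA (n b i : ℕ) : Finset (Finset ℕ) :=
  (sytSet n b).filter (fun S => (tabDes n S).card = i)

lemma mem_setA {n b i : ℕ} {S : Finset ℕ} : S ∈ setA n b i ↔
    S ⊆ Finset.Icc 1 n ∧ S.card = b ∧
      (∀ m, 1 ≤ m → m ≤ n → 2 * (S ∩ Finset.Icc 1 m).card ≤ m) ∧ (tabDes n S).card = i := by
  simp only [setA, sytSet, Finset.mem_filter, Finset.mem_powerset, Finset.mem_Icc, and_assoc,
    and_imp]

noncomputable def GA (n b i : ℕ) : Polynomial ℚ := ∑ S ∈ setA n b i, X ^ tabMaj n S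

noncomputable def GU (n b i : ℕ) : Polynomial ℚ :=
  ∑ S ∈ (setA n b i).filter (fun S => n ∈ S), X ^ tabMaj n S

lemma subset_of_not_mem {n : ℕ} {S : Finset ℕ} (h : S ⊆ Finset.Icc 1 (n+1)) (hn : n+1 ∉ S) :
    S ⊆ Finset.Icc 1 n := by
  intro x hx
  have := Finset.mem_Icc.1 (h hx)
  have : x ≠ n+1 := by rintro rfl; exact hn hx
  exact Finset.mem_Icc.2 (by omega)

lemma subset_succ {n : ℕ} {S : Finset ℕ} (h : S ⊆ Finset.Icc 1 n) : S ⊆ Finset.Icc 1 (n+1) :=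
  h.trans (Finset.Icc_subset_Icc le_rfl (by omega))

lemma top_not_mem {n m : ℕ} {S : Finset ℕ} (h : S ⊆ Finset.Icc 1 n) (hm : n < m) : m ∉ S := by
  intro hx
  have := Finset.mem_Icc.1 (h hx)
  omega

lemma setA_not_top {n b i : ℕ} (hb : 2 * b ≤ n + 1) :
    (setA (n+1) b i).filter (fun S => ¬ (n+1 ∈ S)) = setA n b i := by
  ext S
  simp only [Finset.mem_filter, mem_setA]
  constructor
  · rintro ⟨⟨h1, h2, h3, h4⟩, h5⟩
    rw [tabDes_succ h1] at h4
    exact ⟨subset_of_not_mem h1 h5, h2, fun m hm hm' => h3 m hm (by omega), h4⟩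
  · rintro ⟨h1, h2, h3, h4⟩
    refine ⟨⟨subset_succ h1, h2, ?_, ?_⟩, top_not_mem h1 (by omega)⟩
    · intro m hm hm'
      rcases Nat.lt_or_ge n m with h | h
      · have : m = n + 1 := by omega
        subst this
        have := Finset.card_le_card (Finset.inter_subset_left (s₁ := S) (s₂ := Finset.Icc 1 (n+1)))
        omega
      · exact h3 m hm h
    · rw [tabDes_succ (subset_succ h1)]; exact h4

lemma GA_succ {n b i : ℕ} (hb : 2 * b ≤ n + 1) : GA (n+1) b i = GA n b i + GU (n+1) b i := by
  have := Finset.sum_filter_add_sum_filter_not (setA (n+1) b i) (fun S => n+1 ∈ S)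
    (fun S => (X : Polynomial ℚ) ^ tabMaj (n+1) S)
  rw [GA, ← this, add_comm, GU]
  congr 1
  rw [setA_not_top hb, GA]
  refine Finset.sum_congr rfl fun S hS => ?_
  rw [tabMaj, tabMaj, tabDes_succ (subset_succ (mem_setA.1 hS).1)]

lemma insert_inter {n m : ℕ} {T : Finset ℕ} (h : m < n) :
    insert n T ∩ Finset.Icc 1 m = T ∩ Finset.Icc 1 m := by
  ext x
  simp only [Finset.mem_inter, Finset.mem_insert, Finset.mem_Icc]
  constructor
  · rintro ⟨h1 | h1, h2⟩
    · omega
    · exact ⟨h1, h2⟩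
  · rintro ⟨h1, h2⟩
    exact ⟨Or.inr h1, h2⟩

lemma ballot_insert {n b : ℕ} {T : Finset ℕ} (hT : T.card = b) (hb : 2 * b ≤ n)
    (h : ∀ m, 1 ≤ m → m ≤ n → 2 * (T ∩ Finset.Icc 1 m).card ≤ m) :
    ∀ m, 1 ≤ m → m ≤ n+2 → 2 * (insert (n+2) T ∩ Finset.Icc 1 m).card ≤ m := by
  intro m hm hm'
  rcases Nat.lt_or_ge m (n+2) with h1 | h1
  · rw [insert_inter h1]
    rcases Nat.lt_or_ge n m with h2 | h2
    · have := Finset.card_le_card (Finset.inter_subset_left (s₁ := T) (s₂ := Finset.Icc 1 m))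
      omega
    · exact h m hm h2
  · have := Finset.card_le_card
      (Finset.inter_subset_left (s₁ := insert (n+2) T) (s₂ := Finset.Icc 1 m))
    have := Finset.card_insert_le (n+2) T
    omega

lemma ballot_erase {n : ℕ} {S : Finset ℕ}
    (h : ∀ m, 1 ≤ m → m ≤ n+2 → 2 * (S ∩ Finset.Icc 1 m).card ≤ m) (k : ℕ) :
    ∀ m, 1 ≤ m → m ≤ n+2 → 2 * (S.erase k ∩ Finset.Icc 1 m).card ≤ m := by
  intro m hm hm'
  have := Finset.card_le_card (Finset.inter_subset_inter_right
    (u := Finset.Icc 1 m) (Finset.erase_subset k S))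
  have := h m hm hm'
  omega

lemma subset_insert {n : ℕ} {T : Finset ℕ} (h : T ⊆ Finset.Icc 1 (n+1)) :
    insert (n+2) T ⊆ Finset.Icc 1 (n+2) :=
  Finset.insert_subset (Finset.mem_Icc.2 (by omega)) (subset_succ h)

lemma subset_erase {n : ℕ} {S : Finset ℕ} (h : S ⊆ Finset.Icc 1 (n+2)) :
    S.erase (n+2) ⊆ Finset.Icc 1 (n+1) :=
  subset_of_not_mem ((Finset.erase_subset _ _).trans h) (Finset.notMem_erase _ _)

lemma GU_succ {n b i : ℕ} (hb : 2 * b ≤ n) :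
    GU (n+2) (b+1) (i+1) = GU (n+1) b (i+1) + X ^ (n+1) * GA n b i := by
  have := Finset.sum_filter_add_sum_filter_not ((setA (n+2) (b+1) (i+1)).filter (fun S => n+2 ∈ S))
    (fun S => n+1 ∈ S) (fun S => (X : Polynomial ℚ) ^ tabMaj (n+2) S)
  rw [GU, ← this]
  refine congrArg₂ (· + ·) ?_ ?_
  · rw [GU]
    refine Finset.sum_bij' (fun S _ => S.erase (n+2)) (fun T _ => insert (n+2) T) ?_ ?_ ?_ ?_ ?_
    · intro S hS
      simp only [Finset.mem_filter, mem_setA] at hS ⊢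
      obtain ⟨⟨⟨h1, h2, h3, h4⟩, h5⟩, h6⟩ := hS
      have hm : n+1 ∈ S.erase (n+2) := Finset.mem_erase.2 ⟨by omega, h6⟩
      refine ⟨⟨subset_erase h1, ?_, ?_, ?_⟩, hm⟩
      · rw [Finset.card_erase_of_mem h5]; omega
      · exact fun m hm hm' => ballot_erase h3 _ m hm (by omega)
      · rw [← tabDes_insert (subset_erase h1) hm, Finset.insert_erase h5, h4]
    · intro T hT
      simp only [Finset.mem_filter, mem_setA] at hT ⊢
      obtain ⟨⟨h1, h2, h3, h4⟩, h5⟩ := hT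
      refine ⟨⟨⟨subset_insert h1, ?_, ?_, ?_⟩, Finset.mem_insert_self _ _⟩,
        Finset.mem_insert_of_mem h5⟩
      · rw [Finset.card_insert_of_notMem (top_not_mem h1 (by omega)), h2]
      · exact ballot_insert h2 hb (fun m hm hm' => h3 m hm (by omega))
      · rw [tabDes_insert h1 h5, h4]
    · intro S hS
      simp only [Finset.mem_filter] at hS
      exact Finset.insert_erase hS.1.2
    · intro T hT
      simp only [Finset.mem_filter, mem_setA] at hT
      exact Finset.erase_insert (top_not_mem hT.1.1 (by omega))
    · intro S hS
      simp only [Finset.mem_filter, mem_setA] at hS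
      obtain ⟨⟨⟨h1, h2, h3, h4⟩, h5⟩, h6⟩ := hS
      have hm : n+1 ∈ S.erase (n+2) := Finset.mem_erase.2 ⟨by omega, h6⟩
      rw [tabMaj, tabMaj, ← tabDes_insert (subset_erase h1) hm, Finset.insert_erase h5]
  · rw [GA, Finset.mul_sum]
    refine Finset.sum_bij' (fun S _ => S.erase (n+2)) (fun T _ => insert (n+2) T) ?_ ?_ ?_ ?_ ?_
    · intro S hS
      simp only [Finset.mem_filter, mem_setA] at hS ⊢
      obtain ⟨⟨⟨h1, h2, h3, h4⟩, h5⟩, h6⟩ := hS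
      have hm : n+1 ∉ S.erase (n+2) := fun h => h6 (Finset.mem_of_mem_erase h)
      have hs := subset_of_not_mem (subset_erase h1) hm
      refine ⟨hs, ?_, ?_, ?_⟩
      · rw [Finset.card_erase_of_mem h5]; omega
      · exact fun m hm hm' => ballot_erase h3 _ m hm (by omega)
      · have h7 := tabDes_insert2 hs
        rw [Finset.insert_erase h5] at h7
        rw [h7, Finset.card_insert_of_notMem (not_mem_tabDes (by omega))] at h4
        omega
    · intro T hT
      simp only [Finset.mem_filter, mem_setA] at hT ⊢
      obtain ⟨h1, h2, h3, h4⟩ := hT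
      refine ⟨⟨⟨subset_insert (subset_succ h1), ?_, ?_, ?_⟩, Finset.mem_insert_self _ _⟩, ?_⟩
      · rw [Finset.card_insert_of_notMem (top_not_mem h1 (by omega)), h2]
      · exact ballot_insert h2 hb h3
      · rw [tabDes_insert2 h1, Finset.card_insert_of_notMem (not_mem_tabDes (by omega)), h4]
      · intro h
        rcases Finset.mem_insert.1 h with h | h
        · omega
        · exact top_not_mem h1 (by omega) h
    · intro S hS
      simp only [Finset.mem_filter] at hS
      exact Finset.insert_erase hS.1.2
    · intro T hT
      simp only [mem_setA] at hT
      exact Finset.erase_insert (top_not_mem hT.1 (by omega))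
    · intro S hS
      simp only [Finset.mem_filter, mem_setA] at hS
      obtain ⟨⟨⟨h1, h2, h3, h4⟩, h5⟩, h6⟩ := hS
      have hm : n+1 ∉ S.erase (n+2) := fun h => h6 (Finset.mem_of_mem_erase h)
      have hs := subset_of_not_mem (subset_erase h1) hm
      have h7 := tabDes_insert2 hs
      rw [Finset.insert_erase h5] at h7
      rw [tabMaj, tabMaj, h7, Finset.sum_insert (not_mem_tabDes (by omega)), pow_add]
      rfl

lemma GA_rec {n b i : ℕ} (hb : 2 * b ≤ n) :
    GA (n+2) (b+1) (i+1) = GA (n+1) (b+1) (i+1) + (GA (n+1) b (i+1) - GA n b (i+1))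
      + X ^ (n+1) * GA n b i := by
  have h1 := GA_succ (n := n+1) (b := b+1) (i := i+1) (by omega)
  have h2 := GA_succ (n := n) (b := b) (i := i+1) (by omega)
  have h3 := GU_succ (n := n) (b := b) (i := i) hb
  rw [h1, h3, h2]; ring

lemma GA_zero_of_lt {n b i : ℕ} (h : n < 2 * b) : GA n b i = 0 := by
  have : setA n b i = ∅ := by
    rw [Finset.eq_empty_iff_forall_notMem]
    intro S hS
    obtain ⟨h1, h2, h3, h4⟩ := mem_setA.1 hS
    rcases Nat.eq_zero_or_pos n with hn | hn
    · subst hn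
      have : S = ∅ := by simpa using h1
      subst this
      simp at h2
      omega
    · have := h3 n hn le_rfl
      rw [Finset.inter_eq_left.2 h1] at this
      omega
  rw [GA, this, Finset.sum_empty]

lemma setA_zero (n i : ℕ) : setA n 0 i = if i = 0 then {∅} else ∅ := by
  ext S
  have he : tabDes n ∅ = ∅ := by simp [tabDes]
  rw [mem_setA]
  constructor
  · rintro ⟨h1, h2, h3, h4⟩
    have h2' := Finset.card_eq_zero.1 h2
    subst h2'
    rw [he] at h4
    simp at h4
    simp [← h4]
  · split_ifs with h
    · intro hS
      have hS := Finset.mem_singleton.1 hS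
      subst hS
      simp [he, h]
    · simp

lemma GA_b_zero (n i : ℕ) : GA n 0 i = if i = 0 then 1 else 0 := by
  rw [GA, setA_zero]
  split_ifs
  · simp [tabMaj, tabDes]
  · simp

lemma GA_i_zero (n b : ℕ) : GA n (b+1) 0 = 0 := by
  have : setA n (b+1) 0 = ∅ := by
    rw [Finset.eq_empty_iff_forall_notMem]
    intro S hS
    obtain ⟨h1, h2, h3, h4⟩ := mem_setA.1 hS
    have hne : S.Nonempty := Finset.card_pos.1 (by omega)
    have hmin := Finset.min'_mem S hne
    have hI := Finset.mem_Icc.1 (h1 hmin)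
    have hlt : ∀ x ∈ S, S.min' hne ≤ x := fun x hx => Finset.min'_le S x hx
    generalize S.min' hne = m at *
    have hm1 : m ≠ 1 := by
      rintro rfl
      have h5 := h3 1 le_rfl hI.2
      have : 0 < (S ∩ Finset.Icc 1 1).card := Finset.card_pos.2 ⟨1, by simp [hmin]⟩
      omega
    have h6 := Finset.card_eq_zero.1 h4
    have : m - 1 ∈ tabDes n S := by
      simp only [tabDes, Finset.mem_filter, Finset.mem_Icc]
      refine ⟨by omega, ?_, ?_⟩
      · rwa [Nat.sub_add_cancel hI.1]
      · intro h; have := hlt _ h; omega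
    rw [h6] at this
    simp at this
  rw [GA, this, Finset.sum_empty]

lemma one_sub_X_pow_ne (n : ℕ) : (1 - RatFunc.X ^ (n+1) : RatFunc ℚ) ≠ 0 := by
  intro h
  have h1 : (RatFunc.X : RatFunc ℚ) ^ (n+1) = 1 := (sub_eq_zero.1 h).symm
  rw [← RatFunc.algebraMap_X, ← map_pow, ← map_one (algebraMap (Polynomial ℚ) (RatFunc ℚ))] at h1
  have h2 := RatFunc.algebraMap_injective ℚ h1
  have := congrArg Polynomial.natDegree h2
  simp at this

lemma qPoch_ne (n : ℕ) : qPoch n ≠ 0 := Finset.prod_ne_zero_iff.2 fun j _ => one_sub_X_pow_ne j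

lemma qPoch_succ (n : ℕ) : qPoch (n+1) = qPoch n * (1 - RatFunc.X ^ (n+1)) :=
  Finset.prod_range_succ _ _

lemma gauss_zero (M : ℕ) : gaussBinom M 0 = 1 := by
  simp [gaussBinom, qPoch_ne, show qPoch 0 = 1 from rfl]

lemma gauss_lt {M N : ℕ} (h : M < N) : gaussBinom M N = 0 := by
  rw [gaussBinom, if_neg (by omega)]

lemma gauss_succ_succ (M N : ℕ) : gaussBinom (M+1) (N+1) =
    (1 - RatFunc.X ^ (M+1)) / (1 - RatFunc.X ^ (N+1)) * gaussBinom M N := by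
  by_cases h : N ≤ M
  · rw [gaussBinom, gaussBinom, if_pos h, if_pos (by omega), Nat.add_sub_add_right, qPoch_succ,
      qPoch_succ]
    have := qPoch_ne N
    have := qPoch_ne (M-N)
    have := one_sub_X_pow_ne N
    field_simp
  · rw [gauss_lt (by omega), gauss_lt (by omega), mul_zero]

lemma gauss_succ (N s : ℕ) : gaussBinom (N+s) (N+1) =
    (1 - RatFunc.X ^ s) / (1 - RatFunc.X ^ (N+1)) * gaussBinom (N+s) N := by
  rcases s with _ | s
  · rw [gauss_lt (by omega)]; simp
  · rw [gaussBinom, gaussBinom, if_pos (by omega), if_pos (by omega),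
      show N + (s+1) - (N+1) = s by omega, show N + (s+1) - N = s+1 by omega, qPoch_succ N,
      qPoch_succ s]
    have := qPoch_ne N
    have := qPoch_ne s
    have := one_sub_X_pow_ne N
    have := one_sub_X_pow_ne s
    field_simp

noncomputable def RR (d b i : ℕ) : RatFunc ℚ :=
  RatFunc.X ^ (b + 1 + (i+1) * i) * (1 - RatFunc.X ^ d) / (1 - RatFunc.X ^ (i+1))
    * gaussBinom b i * gaussBinom (b+d) i

lemma RR_rec (d b i : ℕ) : RR (d+1) (b+1) (i+1) = RR d (b+1) (i+1) +
    (RR (d+2) b (i+1) - RR (d+1) b (i+1)) + RatFunc.X ^ (2*b+d+3) * RR (d+1) b i := by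
  by_cases h : i ≤ b
  · obtain ⟨s, rfl⟩ := Nat.exists_eq_add_of_le h
    simp only [RR]
    rw [show i + s + 1 + (d+1) = (i + (s+d+1)) + 1 by ring, show i + s + 1 + d = (i+(s+d)) + 1 by ring,
      show i + s + (d+2) = (i + (s+d+1)) + 1 by ring, show i + s + (d+1) = i + (s+d+1) by ring]
    rw [gauss_succ_succ (i+s), gauss_succ_succ (i+(s+d+1)), gauss_succ i s, gauss_succ i (s+d+1),
      show i + (s+d) + 1 = i + (s+d+1) by ring, gauss_succ i (s+d+1)]
    generalize gaussBinom (i+s) i = G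
    generalize gaussBinom (i+(s+d+1)) i = H
    have h1 := one_sub_X_pow_ne i
    have h2 := one_sub_X_pow_ne (i+1)
    generalize (RatFunc.X : RatFunc ℚ) = q at *
    field_simp
    ring
  · simp only [RR]
    rw [gauss_lt (show b < i by omega), gauss_lt (show b < i+1 by omega),
      gauss_lt (show b + 1 < i+1 by omega)]
    ring

lemma RR_rec0 (d b : ℕ) : RR (d+1) (b+1) 0 = RR d (b+1) 0 +
    (RR (d+2) b 0 - RR (d+1) b 0) := by
  simp only [RR, gauss_zero]
  have h1 := one_sub_X_pow_ne 0
  generalize (RatFunc.X : RatFunc ℚ) = q at *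
  field_simp
  ring

lemma RR_base0 (d : ℕ) : RR (d+1) 0 0 = RR d 0 0 + RatFunc.X ^ (d+1) := by
  simp only [RR, gauss_zero]
  have h1 := one_sub_X_pow_ne 0
  generalize (RatFunc.X : RatFunc ℚ) = q at *
  field_simp
  ring

lemma RR_base1 (d i : ℕ) : RR d 0 (i+1) = 0 := by
  simp only [RR]
  rw [gauss_lt (show 0 < i+1 by omega)]
  ring

lemma RR_zero (b i : ℕ) : RR 0 b i = 0 := by simp [RR]

lemma main_aux (n : ℕ) : ∀ d b i, n = 2 * b + 1 + d →
    algebraMap (Polynomial ℚ) (RatFunc ℚ) (GA n (b+1) (i+1)) = RR d b i := by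
  induction n using Nat.strong_induction_on with
  | _ n ih =>
  intro d b i hn
  rcases d with _ | d
  · rw [GA_zero_of_lt (by omega), RR_zero, map_zero]
  obtain ⟨m, rfl⟩ : ∃ m, n = m + 2 := ⟨2*b+d, by omega⟩
  have hm : m = 2 * b + d := by omega
  rw [GA_rec (by omega)]
  simp only [map_add, map_sub, map_mul, map_pow, RatFunc.algebraMap_X]
  rw [ih (m+1) (by omega) d b i (by omega)]
  rcases b with _ | b
  · simp only [GA_b_zero]
    rcases i with _ | i
    · rw [RR_base0]; simp [hm]
    · rw [RR_base1, RR_base1]; simp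
  · rw [ih (m+1) (by omega) (d+2) b i (by omega), ih m (by omega) (d+1) b i (by omega)]
    rcases i with _ | i
    · rw [GA_i_zero, RR_rec0]; simp
    · rw [ih m (by omega) (d+1) b i (by omega), RR_rec, show m + 1 = 2*b+d+3 by omega]

theorem sytMajGF_formula (n k i : ℕ) (hk : 1 ≤ k) (hn : 2 * k ≤ n) (hi : 1 ≤ i) :
    algebraMap (Polynomial ℚ) (RatFunc ℚ) (sytMajGF (n - k) k i) =
      RatFunc.X ^ (k + i ^ 2 - i) * (1 - RatFunc.X ^ (n - 2 * k + 1)) / (1 - RatFunc.X ^ i)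
        * gaussBinom (k - 1) (i - 1) * gaussBinom (n - k) (i - 1) := by
  obtain ⟨b, rfl⟩ := Nat.exists_eq_add_of_le' hk
  obtain ⟨j, rfl⟩ := Nat.exists_eq_add_of_le' hi
  have h := main_aux n (n - 2 * (b+1) + 1) b j (by omega)
  have h0 : sytMajGF (n - (b+1)) (b+1) (j+1) = GA n (b+1) (j+1) := by
    unfold sytMajGF
    rw [show n - (b+1) + (b+1) = n by omega]
    rfl
  have h1 : b + 1 + (j+1)^2 - (j+1) = b + 1 + (j+1) * j := by
    have : (j+1)^2 = (j+1)*j + (j+1) := by ring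
    omega
  rw [h0, h, RR, h1, show b + (n - 2 * (b+1) + 1) = n - (b+1) by omega]
  rfl
end

section
/- The generating polynomial by major index of 321-avoiding permutations of length n with exactly 2 descents is a symmetric and unimodal polynomial in q. -/
open Finset Polynomial
open scoped Classical

/-- The descent set of a permutation `σ` of `{1,…,n}` (as a permutation of `Fin n`,
written in one-line notation with 1-based positions): those positions `i ∈ {1,…,n-1}`
with `σ(i) > σ(i+1)`. -/
noncomputable def permDes (n : ℕ) (σ : Equiv.Perm (Fin n)) : Finset ℕ :=
  (Finset.Ico 1 n).filter (fun i => ∀ h : i < n, σ ⟨i, h⟩ < σ ⟨i - 1, by omega⟩)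

/-- The major index: the sum of the descent positions. -/
noncomputable def permMaj (n : ℕ) (σ : Equiv.Perm (Fin n)) : ℕ := (permDes n σ).sum id

/-- `σ` avoids the pattern 321. -/
def Avoids321 {n : ℕ} (σ : Equiv.Perm (Fin n)) : Prop :=
  ¬ ∃ i j k : Fin n, i < j ∧ j < k ∧ σ k < σ j ∧ σ j < σ i

/-- `σ` avoids the pattern 132. -/
def Avoids132 {n : ℕ} (σ : Equiv.Perm (Fin n)) : Prop :=
  ¬ ∃ i j k : Fin n, i < j ∧ j < k ∧ σ i < σ k ∧ σ k < σ j

/-- `σ` avoids the pattern 231. -/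
def Avoids231 {n : ℕ} (σ : Equiv.Perm (Fin n)) : Prop :=
  ¬ ∃ i j k : Fin n, i < j ∧ j < k ∧ σ k < σ i ∧ σ i < σ j

/-- `A n i = ∑ q^{maj σ}` over 321-avoiding permutations of length `n` with exactly
`i` descents. -/
noncomputable def A (n i : ℕ) : Polynomial ℚ :=
  (Finset.univ.filter
      (fun σ : Equiv.Perm (Fin n) => Avoids321 σ ∧ (permDes n σ).card = i)).sum
    (fun σ => Polynomial.X ^ permMaj n σ)

/-- A polynomial (with nonnegative coefficients) is unimodal if its coefficient sequence
first weakly increases, then weakly decreases. -/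
def PolyUnimodal (p : Polynomial ℚ) : Prop :=
  ∃ t : ℕ, (∀ a b : ℕ, a ≤ b → b ≤ t → p.coeff a ≤ p.coeff b) ∧
    (∀ a b : ℕ, t ≤ a → a ≤ b → p.coeff b ≤ p.coeff a)

/-- Partial row sums of Pascal's triangle (exclusive upper bound). -/
def binF (n k : ℕ) : ℤ := ∑ j ∈ Finset.range k, (n.choose j : ℤ)

lemma binF_succ (n k : ℕ) : binF n (k + 1) = binF n k + n.choose k := by
  simp [binF, Finset.sum_range_succ]

lemma binF_zero (n : ℕ) : binF n 0 = 0 := by simp [binF]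

lemma binF_one (n : ℕ) : binF n 1 = 1 := by simp [binF]

lemma binF_pascal (n k : ℕ) : binF (n + 1) (k + 1) = binF n (k + 1) + binF n k := by
  induction k with
  | zero => simp [binF]
  | succ k ih =>
    rw [binF_succ, ih, binF_succ n (k + 1), binF_succ n k, Nat.choose_succ_succ]
    push_cast; ring

lemma binF_full (n : ℕ) : binF n (n + 1) = 2 ^ n := by
  rw [binF, ← Nat.cast_sum, Nat.sum_range_choose]; simp

lemma binF_compl (n a b : ℕ) (h : a + b = n + 1) : binF n a + binF n b = 2 ^ n := by
  induction a generalizing b with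
  | zero =>
    have : b = n + 1 := by omega
    subst this; rw [binF_full, binF_zero]; simp
  | succ a ih =>
    have h2 := ih (b + 1) (by omega)
    rw [binF_succ] at h2 ⊢
    have : n.choose a = n.choose b := by
      rw [← Nat.choose_symm_of_eq_add (show n = a + b by omega)]
    rw [this]; linarith

lemma choose_le_aux (n x : ℕ) : ∀ y, x ≤ y → 2 * y ≤ n + 1 → n.choose x ≤ n.choose y := by
  intro y hxy
  induction y, hxy using Nat.le_induction with
  | base => intro _; exact le_rfl
  | succ y hy ih =>
    intro h
    exact (ih (by omega)).trans (by
      by_cases h1 : y < n / 2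
      · exact Nat.choose_le_succ_of_lt_half_left h1
      · have : n = y + (y + 1) := by omega
        exact (Nat.choose_symm_of_eq_add this).le)

lemma choose_le_of_add_le (n x y : ℕ) (h : x ≤ y) (h2 : x + y ≤ n) :
    n.choose x ≤ n.choose y := by
  by_cases h3 : 2 * y ≤ n + 1
  · exact choose_le_aux n x y h h3
  · rw [← Nat.choose_symm (show y ≤ n by omega)]
    exact choose_le_aux n x (n - y) (by omega) (by omega)

lemma pairing (n q M : ℕ) (hM : M = 2 * q ∨ M + 1 = 2 * q) (hn : M + 1 ≤ n) :
    ∑ k ∈ Finset.range q, (n.choose (M - 2 * k) : ℤ) ≤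
      ∑ k ∈ Finset.range q, (n.choose (M - k) : ℤ) := by
  let π : ℕ → ℕ := fun k => if 2 * k < q then 2 * k else 2 * (q - 1 - k) + 1
  have hinj : Set.InjOn π (Finset.range q : Set ℕ) := by
    intro a ha b hb hab
    simp only [Finset.coe_range, Set.mem_Iio] at ha hb
    simp only [π] at hab
    split_ifs at hab <;> omega
  calc _ ≤ ∑ k ∈ Finset.range q, (n.choose (M - π k) : ℤ) := by
        apply Finset.sum_le_sum
        intro k hk
        rw [Finset.mem_range] at hk
        simp only [π]
        split_ifs with h
        · exact le_rfl
        · exact_mod_cast choose_le_of_add_le _ _ _ (by omega) (by omega)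
    _ = ∑ k ∈ (Finset.range q).image π, (n.choose (M - k) : ℤ) := by
        rw [Finset.sum_image hinj]
    _ ≤ _ := by
        apply Finset.sum_le_sum_of_subset_of_nonneg
        · intro k hk
          simp only [Finset.mem_image, Finset.mem_range, π] at hk ⊢
          obtain ⟨a, ha, rfl⟩ := hk
          split_ifs <;> omega
        · intros; positivity

/-- The number of 321-avoiding permutations with descent set `{i, j}`. -/
def dd (n i j : ℕ) : ℤ := 2 ^ n + 1 - binF n (i + 1) - binF n (j - i) - binF n (n - j + 1)

/-- Closed form for the coefficients. -/
def SS (n M : ℕ) : ℤ := ∑ i ∈ Finset.range ((M + 1) / 2), dd n i (M - i)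

lemma dd_step (n M i : ℕ) (h : 2 * i < M) (hn : M + 1 ≤ n) :
    dd n i (M + 1 - i) - dd n i (M - i) = n.choose (M - i) - n.choose (M - 2 * i) := by
  unfold dd
  rw [show M + 1 - i - i = (M - 2 * i) + 1 by omega, show M - i - i = M - 2 * i by omega,
    show n - (M + 1 - i) + 1 = n - (M - i) by omega, binF_succ n (M - 2 * i),
    binF_succ n (n - (M - i)), Nat.choose_symm (by omega)]
  ring

lemma SS_step (n M : ℕ) (hn : M + 1 ≤ n) : SS n M ≤ SS n (M + 1) := by
  have key : ∑ i ∈ Finset.range ((M + 1) / 2), dd n i (M + 1 - i) = SS n (M + 1) := by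
    unfold SS
    rcases Nat.even_or_odd' M with ⟨q, rfl | rfl⟩
    · rw [show (2 * q + 1) / 2 = q by omega, show (2 * q + 1 + 1) / 2 = q + 1 by omega,
        Finset.sum_range_succ]
      have : dd n q (2 * q + 1 - q) = 0 := by
        unfold dd
        rw [show 2 * q + 1 - q - q = 1 by omega, binF_one]
        have := binF_compl n (q + 1) (n - (2 * q + 1 - q) + 1) (by omega)
        linarith
      rw [this, add_zero]
    · rw [show (2 * q + 1 + 1) / 2 = (2 * q + 1 + 1 + 1) / 2 by omega]
  rw [← key, ← sub_nonneg]
  unfold SS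
  rw [← Finset.sum_sub_distrib, Finset.sum_congr rfl (fun i hi => dd_step n M i
    (by rw [Finset.mem_range] at hi; omega) hn), Finset.sum_sub_distrib, sub_nonneg]
  exact pairing n _ M (by omega) hn

/-- Number of words satisfying a predicate. -/
noncomputable def cnt (n : ℕ) (P : (Fin n → Fin 3) → Prop) : ℕ :=
  (Finset.univ.filter (fun w => P w)).card

lemma cnt_succ (n : ℕ) (P : (Fin (n + 1) → Fin 3) → Prop) :
    cnt (n + 1) P = cnt n (fun w => P (Fin.cons 0 w)) + cnt n (fun w => P (Fin.cons 1 w)) +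
      cnt n (fun w => P (Fin.cons 2 w)) := by
  unfold cnt
  simp only [Finset.card_filter]
  rw [← (Fin.consEquiv (fun _ : Fin (n + 1) => Fin 3)).sum_comp, Fintype.sum_prod_type,
    Fin.sum_univ_three]
  rfl

/-- Number of occurrences of a letter. -/
noncomputable def occ {n : ℕ} (w : Fin n → Fin 3) (x : Fin 3) : ℕ :=
  (Finset.univ.filter (fun p => w p = x)).card

lemma occ_cons {n : ℕ} (w : Fin n → Fin 3) (x y : Fin 3) :
    occ (Fin.cons y w : Fin (n + 1) → Fin 3) x = (if y = x then 1 else 0) + occ w x := by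
  unfold occ
  rw [Fin.card_filter_univ_succ]
  simp only [Fin.cons_zero, Function.comp_def, Fin.cons_succ]
  split_ifs <;> omega

/-- words avoiding the subword `10`. -/
def No10 {n : ℕ} (w : Fin n → Fin 3) : Prop := ¬ ∃ x y, x < y ∧ w x = 1 ∧ w y = 0

/-- words avoiding the subword `210`. -/
def No210 {n : ℕ} (w : Fin n → Fin 3) : Prop :=
  ¬ ∃ x y z, x < y ∧ y < z ∧ w x = 2 ∧ w y = 1 ∧ w z = 0

lemma occ_zero_iff {n : ℕ} (w : Fin n → Fin 3) (x : Fin 3) : occ w x = 0 ↔ ∀ p, w p ≠ x := by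
  simp [occ, Finset.card_eq_zero, Finset.filter_eq_empty_iff]

lemma no10_cons {n : ℕ} (w : Fin n → Fin 3) (c : Fin 3) :
    No10 (Fin.cons c w : Fin (n + 1) → Fin 3) ↔ No10 w ∧ (c = 1 → occ w 0 = 0) := by
  rw [occ_zero_iff]
  unfold No10
  rw [Fin.exists_fin_succ]
  simp only [Fin.exists_fin_succ, Fin.cons_zero, Fin.cons_succ, Fin.succ_lt_succ_iff, lt_irrefl,
    Fin.succ_pos, Fin.not_lt_zero, false_and, false_or, true_and]
  grind

lemma no210_cons {n : ℕ} (w : Fin n → Fin 3) (c : Fin 3) :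
    No210 (Fin.cons c w : Fin (n + 1) → Fin 3) ↔ No210 w ∧ (c = 2 → No10 w) := by
  unfold No10 No210
  rw [Fin.exists_fin_succ]
  simp only [Fin.exists_fin_succ, Fin.cons_zero, Fin.cons_succ, Fin.succ_lt_succ_iff, lt_irrefl,
    Fin.succ_pos, Fin.not_lt_zero, false_and, false_or, true_and, exists_false, and_false]
  grind

lemma No10.no210 {n : ℕ} {w : Fin n → Fin 3} (h : No10 w) : No210 w := by
  rintro ⟨x, y, z, _, h2, _, h3, h4⟩
  exact h ⟨y, z, h2, h3, h4⟩

lemma cnt_false {n : ℕ} {P : (Fin n → Fin 3) → Prop} (h : ∀ w, ¬ P w) : cnt n P = 0 := by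
  simp [cnt, Finset.card_eq_zero, Finset.filter_eq_empty_iff, h]

lemma cnt_congr {n : ℕ} {P Q : (Fin n → Fin 3) → Prop} (h : ∀ w, P w ↔ Q w) :
    cnt n P = cnt n Q := by
  rw [funext (fun w => propext (h w))]

/-- Words of content `(a, b, c)` avoiding `10`. -/
def P10 (n a b c : ℕ) (w : Fin n → Fin 3) : Prop :=
  No10 w ∧ occ w 0 = a ∧ occ w 1 = b ∧ occ w 2 = c

/-- Words of content `(a, b, c)` avoiding `210`. -/
def P210 (n a b c : ℕ) (w : Fin n → Fin 3) : Prop :=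
  No210 w ∧ occ w 0 = a ∧ occ w 1 = b ∧ occ w 2 = c

lemma cnt10 (n : ℕ) : ∀ a b c, a + b + c = n → cnt n (P10 n a b c) = n.choose c := by
  induction n with
  | zero =>
    intro a b c h
    obtain ⟨rfl, rfl, rfl⟩ : a = 0 ∧ b = 0 ∧ c = 0 := by omega
    simp [cnt, P10, No10, occ]
  | succ n ih =>
    intro a b c h
    rw [cnt_succ]
    have h2 : cnt n (fun w => P10 (n + 1) a b c (Fin.cons 2 w)) =
        if c = 0 then 0 else n.choose (c - 1) := by
      split_ifs with hc
      · exact cnt_false (by intro w; simp [P10, P210, occ_cons, no10_cons, no210_cons]; try omega)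
      · rw [← ih a b (c - 1) (by omega)]
        exact cnt_congr (by intro w; simp [P10, occ_cons, no10_cons]; grind)
    rw [h2]
    have h01 : cnt n (fun w => P10 (n + 1) a b c (Fin.cons 0 w)) +
        cnt n (fun w => P10 (n + 1) a b c (Fin.cons 1 w)) = n.choose c := by
      by_cases ha : a = 0
      · rw [cnt_false (by intro w; simp [P10, P210, occ_cons, no10_cons, no210_cons]; try omega), zero_add]
        by_cases hb : b = 0
        · rw [cnt_false (by intro w; simp [P10, P210, occ_cons, no10_cons, no210_cons]; try omega), Nat.choose_eq_zero_of_lt (by omega)]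
        · rw [← ih 0 (b - 1) c (by omega)]
          exact cnt_congr (by intro w; simp [P10, occ_cons, no10_cons]; grind)
      · rw [← ih (a - 1) b c (by omega)]
        conv_rhs => rw [← add_zero (cnt n _)]
        congr 1
        · exact cnt_congr (by intro w; simp [P10, occ_cons, no10_cons]; grind)
        · exact cnt_false (by intro w; simp [P10, P210, occ_cons, no10_cons, no210_cons]; try omega)
    rw [h01]
    cases c with
    | zero => simp
    | succ c => simp [Nat.choose_succ_succ]; ring

lemma cnt210 (n : ℕ) : ∀ a b c, a + b + c = n →
    (cnt n (P210 n a b c) : ℤ) = 2 ^ n - binF n a - binF n b - binF n c := by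
  induction n with
  | zero =>
    intro a b c h
    obtain ⟨rfl, rfl, rfl⟩ : a = 0 ∧ b = 0 ∧ c = 0 := by omega
    simp [cnt, P210, No210, occ, binF]
  | succ n ih =>
    intro a b c h
    rw [cnt_succ]
    have h0 : (cnt n (fun w => P210 (n + 1) a b c (Fin.cons 0 w)) : ℤ) =
        2 ^ n - binF n (a - 1) - binF n b - binF n c := by
      by_cases ha : a = 0
      · rw [cnt_false (by intro w; simp [P10, P210, occ_cons, no10_cons, no210_cons]; try omega), ha, Nat.zero_sub, binF_zero]
        have := binF_compl n b c (by omega)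
        push_cast; linarith
      · rw [← ih (a - 1) b c (by omega)]
        congr 1
        exact cnt_congr (by intro w; simp [P210, occ_cons, no210_cons]; grind)
    have h1 : (cnt n (fun w => P210 (n + 1) a b c (Fin.cons 1 w)) : ℤ) =
        2 ^ n - binF n a - binF n (b - 1) - binF n c := by
      by_cases ha : b = 0
      · rw [cnt_false (by intro w; simp [P10, P210, occ_cons, no10_cons, no210_cons]; try omega), ha, Nat.zero_sub, binF_zero]
        have := binF_compl n a c (by omega)
        push_cast; linarith
      · rw [← ih a (b - 1) c (by omega)]
        congr 1
        exact cnt_congr (by intro w; simp [P210, occ_cons, no210_cons]; grind)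
    have h2 : (cnt n (fun w => P210 (n + 1) a b c (Fin.cons 2 w)) : ℤ) =
        binF n c - binF n (c - 1) := by
      by_cases hc : c = 0
      · rw [cnt_false (by intro w; simp [P10, P210, occ_cons, no10_cons, no210_cons]; try omega), hc]
        simp
      · obtain ⟨c, rfl⟩ := Nat.exists_eq_succ_of_ne_zero hc
        rw [Nat.succ_eq_add_one, binF_succ, Nat.add_sub_cancel, ← cnt10 n a b c (by omega)]
        rw [add_sub_cancel_left]
        congr 1
        refine cnt_congr (fun w => ?_)
        have := @No10.no210 n w
        simp [P10, P210, occ_cons, no210_cons]; grind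
    push_cast
    rw [h0, h1, h2]
    have hp : ∀ k, binF (n + 1) k = binF n k + binF n (k - 1) := by
      intro k
      cases k with
      | zero => simp [binF]
      | succ k => exact binF_pascal n k
    rw [hp a, hp b, hp c, pow_succ]
    ring

/-- The block of a position. -/
def blk (n i j : ℕ) (p : Fin n) : Fin 3 :=
  if (p : ℕ) < i then 0 else if (p : ℕ) < j then 1 else 2

lemma blk_mono (n i j : ℕ) (hij : i ≤ j) : Monotone (blk n i j) := by
  intro p q hpq
  have : (p : ℕ) ≤ q := hpq
  unfold blk
  split_ifs <;> first | omega | decide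

lemma mem_permDes (n : ℕ) (σ : Equiv.Perm (Fin n)) (i : ℕ) :
    i ∈ permDes n σ ↔ ∃ (h1 : 1 ≤ i) (h : i < n), σ ⟨i, h⟩ < σ ⟨i - 1, by omega⟩ := by
  unfold permDes
  rw [Finset.mem_filter, Finset.mem_Ico]
  constructor
  · rintro ⟨⟨h1, h2⟩, h3⟩
    exact ⟨h1, h2, h3 h2⟩
  · rintro ⟨h1, h2, h3⟩
    exact ⟨⟨h1, h2⟩, fun _ => h3⟩

lemma lt_of_no_des (n : ℕ) (σ : Equiv.Perm (Fin n)) (p : ℕ) (hp : p < n) (q : ℕ) (hpq : p + 1 ≤ q) :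
    ∀ hq : q < n, (∀ r, p < r → r ≤ q → r ∉ permDes n σ) → σ ⟨p, hp⟩ < σ ⟨q, hq⟩ := by
  have step : ∀ r (hr : r + 1 < n), r + 1 ∉ permDes n σ → σ ⟨r, by omega⟩ < σ ⟨r + 1, hr⟩ := by
    intro r hr h
    rw [mem_permDes] at h
    have h' : ¬ σ ⟨r + 1, hr⟩ < σ ⟨r, by omega⟩ := fun h3 => h ⟨by omega, hr, h3⟩
    refine lt_of_le_of_ne (not_lt.mp h') (fun he => ?_)
    have := σ.injective he
    simp at this
  induction q, hpq using Nat.le_induction with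
  | base => intro hq h; exact step p hq (h _ (by omega) (by omega))
  | succ q hq ih =>
    intro hq2 h
    exact (ih (by first | assumption | omega) (by omega) (fun r h1 h2 => h r h1 (by omega))).trans
      (step q hq2 (h _ (by omega) (by omega)))

lemma occ_perm {n : ℕ} (w : Fin n → Fin 3) (σ : Equiv.Perm (Fin n)) (x : Fin 3) :
    occ (w ∘ σ) x = occ w x := by
  unfold occ
  refine Finset.card_bij (fun p _ => σ p) ?_ ?_ ?_
  · intro p hp; simpa using hp
  · intro p _ q _ h; exact σ.injective h
  · intro q hq
    refine ⟨σ.symm q, ?_, by simp⟩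
    simpa using hq

lemma occ_sum {n : ℕ} (w : Fin n → Fin 3) : occ w 0 + occ w 1 + occ w 2 = n := by
  have := Finset.card_eq_sum_card_fiberwise (f := w) (s := Finset.univ) (t := Finset.univ)
    (by intro x _; simp)
  rw [Fin.sum_univ_three] at this
  simp only [Finset.card_univ, Fintype.card_fin] at this
  exact this.symm

lemma card_lt (n i : ℕ) (hi : i ≤ n) :
    (Finset.univ.filter (fun p : Fin n => (p : ℕ) < i)).card = i := by
  rw [Fin.card_filter_val_lt]; omega

lemma occ_blk0 (n i j : ℕ) (hij : i ≤ j) (hj : j ≤ n) : occ (blk n i j) 0 = i := by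
  unfold occ
  conv_rhs => rw [← card_lt n i (by omega)]
  congr 1
  ext p
  simp only [Finset.mem_filter, Finset.mem_univ, true_and]
  unfold blk
  split_ifs <;> simp_all

lemma occ_blk01 (n i j : ℕ) (hij : i ≤ j) (hj : j ≤ n) :
    occ (blk n i j) 0 + occ (blk n i j) 1 = j := by
  unfold occ
  rw [← Finset.card_union_of_disjoint]
  · conv_rhs => rw [← card_lt n j (by omega)]
    congr 1
    ext p
    simp only [Finset.mem_filter, Finset.mem_union, Finset.mem_univ, true_and]
    unfold blk
    split_ifs <;> simp_all
    omega
  · rw [Finset.disjoint_filter]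
    intro x _ h h2
    rw [h] at h2; simp at h2

lemma eq_blk (n i j : ℕ) (f : Fin n → Fin 3) (hf : Monotone f) (h0 : occ f 0 = i)
    (h1 : occ f 0 + occ f 1 = j) : f = blk n i j := by
  have e0 : ∀ p : Fin n, (p : ℕ) < i ↔ f p < 1 := by
    intro p
    rw [← Tuple.lt_card_lt_iff_apply_lt_of_monotone hf, ← h0, occ]
    have : (Finset.univ.filter (fun p => f p = 0)) = Finset.univ.filter (fun p => f p < 1) := by
      ext p; simp
    rw [this]
  have e1 : ∀ p : Fin n, (p : ℕ) < j ↔ f p < 2 := by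
    intro p
    rw [← Tuple.lt_card_lt_iff_apply_lt_of_monotone hf, ← h1, occ, occ,
      ← Finset.card_union_of_disjoint]
    · have : (Finset.univ.filter (fun p => f p = 0)) ∪ (Finset.univ.filter (fun p => f p = 1)) =
          Finset.univ.filter (fun p => f p < 2) := by
        ext p
        simp only [Finset.mem_union, Finset.mem_filter, Finset.mem_univ, true_and]
        generalize f p = y
        revert y; decide
      rw [this]
    · rw [Finset.disjoint_filter]
      intro x _ h h2
      rw [h] at h2; simp at h2
  funext p
  have a := e0 p
  have b := e1 p
  unfold blk
  clear e0 e1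
  generalize f p = y at a b ⊢
  clear hf h0 h1 f
  rw [if_congr a rfl (if_congr b rfl rfl)]
  clear a b
  revert y; decide

/-- 321-avoiding permutations with descents among `i, j`. -/
noncomputable def WW (n i j : ℕ) : Finset (Equiv.Perm (Fin n)) :=
  Finset.univ.filter (fun σ => Avoids321 σ ∧ permDes n σ ⊆ {i, j})

lemma card_WW (n i j : ℕ) (hij : i ≤ j) (hj : j ≤ n) :
    (WW n i j).card = cnt n (P210 n i (j - i) (n - j)) := by
  unfold WW cnt
  refine Finset.card_bij' (fun σ _ => blk n i j ∘ σ.symm) (fun w _ => Tuple.sort w) ?_ ?_ ?_ ?_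
  · intro σ hσ
    rw [Finset.mem_filter] at hσ ⊢
    obtain ⟨-, hav, hd⟩ := hσ
    refine ⟨Finset.mem_univ _, ?_, ?_⟩
    · rintro ⟨x, y, z, hxy, hyz, hx, hy, hz⟩
      apply hav
      have mono := blk_mono n i j hij
      refine ⟨σ.symm z, σ.symm y, σ.symm x, ?_, ?_, by simpa, by simpa⟩
      · by_contra h
        have := mono (not_lt.mp h)
        simp only [Function.comp] at hy hz
        rw [hy, hz] at this
        revert this; decide
      · by_contra h
        have := mono (not_lt.mp h)
        simp only [Function.comp] at hx hy
        rw [hx, hy] at this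
        revert this; decide
    · have h0 := occ_blk0 n i j hij hj
      have h1 := occ_blk01 n i j hij hj
      have h2 := occ_sum (blk n i j)
      simp only [occ_perm]
      omega
  · intro w hw
    rw [Finset.mem_filter] at hw ⊢
    obtain ⟨-, hno, h0, h1, h2⟩ := hw
    obtain ⟨hm, hs⟩ := (Tuple.eq_sort_iff (f := w) (σ := Tuple.sort w)).mp rfl
    have hb : w ∘ Tuple.sort w = blk n i j :=
      eq_blk n i j _ hm (by rw [occ_perm, h0]) (by rw [occ_perm, occ_perm, h0, h1]; omega)
    refine ⟨Finset.mem_univ _, ?_, ?_⟩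
    · rintro ⟨x, y, z, hxy, hyz, hzy, hyx⟩
      apply hno
      have a1 : w (Tuple.sort w x) < w (Tuple.sort w y) :=
        lt_of_le_of_ne (hm hxy.le) (fun he => absurd (hs x y hxy he) (not_lt.mpr hyx.le))
      have a2 : w (Tuple.sort w y) < w (Tuple.sort w z) :=
        lt_of_le_of_ne (hm hyz.le) (fun he => absurd (hs y z hyz he) (not_lt.mpr hzy.le))
      refine ⟨_, _, _, hzy, hyx, ?_⟩
      generalize w (Tuple.sort w x) = u at *
      generalize w (Tuple.sort w y) = v at *
      generalize w (Tuple.sort w z) = t at *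
      revert u v t
      decide
    · intro r hr
      rw [mem_permDes] at hr
      obtain ⟨hr1, hrn, hlt⟩ := hr
      by_contra hne
      simp only [Finset.mem_insert, Finset.mem_singleton, not_or] at hne
      have : w (Tuple.sort w ⟨r - 1, by omega⟩) = w (Tuple.sort w ⟨r, hrn⟩) := by
        have e1 := congrFun hb ⟨r - 1, by omega⟩
        have e2 := congrFun hb ⟨r, hrn⟩
        simp only [Function.comp] at e1 e2
        rw [e1, e2]
        unfold blk
        simp only
        split_ifs <;> first | rfl | omega
      have := hs _ _ (by rw [Fin.lt_def]; simp only; omega) this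
      exact absurd hlt (not_lt.mpr this.le)
  · intro σ hσ
    rw [Finset.mem_filter] at hσ
    obtain ⟨-, hav, hd⟩ := hσ
    symm
    rw [Tuple.eq_sort_iff]
    constructor
    · have : (blk n i j ∘ σ.symm) ∘ σ = blk n i j := by funext p; simp
      rw [this]
      exact blk_mono n i j hij
    · intro p q hpq he
      simp only [Function.comp, Equiv.symm_apply_apply] at he
      refine lt_of_no_des n σ p p.2 q hpq q.2 ?_
      intro r h1 h2 hr
      have := hd hr
      simp only [Finset.mem_insert, Finset.mem_singleton] at this
      unfold blk at he
      split_ifs at he <;> first | omega | simp at he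
  · intro w hw
    rw [Finset.mem_filter] at hw
    obtain ⟨-, hno, h0, h1, h2⟩ := hw
    have hm := Tuple.monotone_sort w
    have hb : w ∘ Tuple.sort w = blk n i j :=
      eq_blk n i j _ hm (by rw [occ_perm, h0]) (by rw [occ_perm, occ_perm, h0, h1]; omega)
    rw [← hb]
    funext p; simp

lemma card_WW' (n i j : ℕ) (hij : i ≤ j) (hj : j ≤ n) :
    ((WW n i j).card : ℤ) = 2 ^ n - binF n i - binF n (j - i) - binF n (n - j) := by
  rw [card_WW n i j hij hj, cnt210 n _ _ _ (by omega)]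

/-- 321-avoiding permutations with descent set exactly `{i, j}`. -/
noncomputable def EE (n i j : ℕ) : Finset (Equiv.Perm (Fin n)) :=
  Finset.univ.filter (fun σ => Avoids321 σ ∧ permDes n σ = {i, j})

lemma des_lt {n : ℕ} {σ : Equiv.Perm (Fin n)} {i : ℕ} (h : i ∈ permDes n σ) : 1 ≤ i ∧ i < n := by
  rw [mem_permDes] at h
  obtain ⟨a, b, _⟩ := h
  exact ⟨a, b⟩

lemma card_EE (n i j : ℕ) (hi : 1 ≤ i) (hij : i < j) (hj : j < n) :
    ((EE n i j).card : ℤ) = dd n i j := by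
  have key : ((EE n i j).card : ℤ) + (WW n i n).card + (WW n j n).card =
      (WW n i j).card + (WW n 0 n).card := by
    unfold EE WW
    simp only [Finset.card_filter]
    push_cast
    rw [← Finset.sum_add_distrib, ← Finset.sum_add_distrib, ← Finset.sum_add_distrib]
    refine Finset.sum_congr rfl (fun σ _ => ?_)
    have hn0 : (0 : ℕ) ∉ permDes n σ := fun h => by have := des_lt h; omega
    have hnn : n ∉ permDes n σ := fun h => by have := des_lt h; omega
    have hsub : ∀ x y, permDes n σ ⊆ {x, y} ↔ ∀ r ∈ permDes n σ, r = x ∨ r = y := by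
      intro x y; simp [Finset.subset_iff]
    have heq : permDes n σ = {i, j} ↔
        permDes n σ ⊆ {i, j} ∧ i ∈ permDes n σ ∧ j ∈ permDes n σ := by
      constructor
      · intro h; rw [h]; simp
      · rintro ⟨h1, h2, h3⟩
        refine h1.antisymm ?_
        intro r hr
        simp only [Finset.mem_insert, Finset.mem_singleton] at hr
        rcases hr with rfl | rfl <;> assumption
    have hA : permDes n σ ⊆ {i, n} ↔ permDes n σ ⊆ {i, j} ∧ j ∉ permDes n σ := by
      rw [hsub, hsub]; grind
    have hB : permDes n σ ⊆ {j, n} ↔ permDes n σ ⊆ {i, j} ∧ i ∉ permDes n σ := by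
      rw [hsub, hsub]; grind
    have hC : permDes n σ ⊆ {0, n} ↔
        permDes n σ ⊆ {i, j} ∧ i ∉ permDes n σ ∧ j ∉ permDes n σ := by
      rw [hsub, hsub]; grind
    simp only [heq, hA, hB, hC]
    by_cases h1 : Avoids321 σ <;> by_cases h2 : permDes n σ ⊆ {i, j} <;>
      by_cases h3 : i ∈ permDes n σ <;> by_cases h4 : j ∈ permDes n σ <;> simp [h1, h2, h3, h4]
  rw [card_WW' n i n (by omega) le_rfl, card_WW' n j n (by omega) le_rfl,
    card_WW' n i j (by omega) (by omega), card_WW' n 0 n (by omega) le_rfl] at key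
  unfold dd
  have a1 := binF_compl n (i + 1) (n - i) (by omega)
  have a2 := binF_compl n j (n - j + 1) (by omega)
  have a3 := binF_compl n 1 n (by omega)
  have a4 := binF_succ n i
  have a5 := binF_succ n (n - j)
  simp only [Nat.sub_self, Nat.sub_zero, binF_zero, binF_one] at *
  linarith

lemma coeff_A (n M : ℕ) : (A n 2).coeff M =
    ((∑ i ∈ (Finset.range M).filter (fun i => 1 ≤ i ∧ i < M - i ∧ M - i < n),
      dd n i (M - i) : ℤ) : ℚ) := by
  have h1 : (A n 2).coeff M = (((Finset.univ.filter (fun σ : Equiv.Perm (Fin n) =>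
      (Avoids321 σ ∧ (permDes n σ).card = 2) ∧ permMaj n σ = M)).card : ℤ) : ℚ) := by
    unfold A
    rw [Polynomial.finset_sum_coeff]
    simp only [Polynomial.coeff_X_pow]
    rw [Finset.sum_boole, Finset.filter_filter]
    simp only [eq_comm (a := M)]
    push_cast
    rfl
  rw [h1]
  congr 1
  have h2 : Finset.univ.filter (fun σ : Equiv.Perm (Fin n) =>
      (Avoids321 σ ∧ (permDes n σ).card = 2) ∧ permMaj n σ = M) =
      ((Finset.range M).filter (fun i => 1 ≤ i ∧ i < M - i ∧ M - i < n)).biUnion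
        (fun i => EE n i (M - i)) := by
    ext σ
    simp only [Finset.mem_filter, Finset.mem_biUnion, Finset.mem_univ, true_and, EE,
      Finset.mem_range]
    constructor
    · rintro ⟨⟨hav, hc⟩, hM⟩
      obtain ⟨x, y, hxy, he⟩ := Finset.card_eq_two.mp hc
      have hx := des_lt (n := n) (σ := σ) (i := x) (by rw [he]; simp)
      have hy := des_lt (n := n) (σ := σ) (i := y) (by rw [he]; simp)
      unfold permMaj at hM
      rw [he, Finset.sum_pair hxy] at hM
      simp only [id] at hM
      rcases lt_or_gt_of_ne hxy with h | h
      · exact ⟨x, by omega, hav, by rw [he]; congr; omega⟩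
      · exact ⟨y, by omega, hav, by rw [he, Finset.pair_comm]; congr; omega⟩
    · rintro ⟨i, ⟨hiM, h1, h2, h3⟩, hav, he⟩
      refine ⟨⟨hav, ?_⟩, ?_⟩
      · rw [he, Finset.card_pair (by omega)]
      · unfold permMaj
        rw [he, Finset.sum_pair (by omega)]
        simp only [id]; omega
  rw [h2, Finset.card_biUnion]
  · push_cast
    refine Finset.sum_congr rfl (fun i hi => ?_)
    rw [Finset.mem_filter] at hi
    exact card_EE n i (M - i) hi.2.1 hi.2.2.1 hi.2.2.2
  · intro x hx y hy hxy
    rw [Finset.mem_coe, Finset.mem_filter] at hx hy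
    simp only [Function.onFun]
    rw [Finset.disjoint_left]
    intro σ h1 h2
    simp only [EE, Finset.mem_filter] at h1 h2
    have h3 : x ∈ permDes n σ := by rw [h1.2.2]; simp
    have h4 : y ∈ permDes n σ := by rw [h2.2.2]; simp
    rw [h2.2.2] at h3
    rw [h1.2.2] at h4
    simp only [Finset.mem_insert, Finset.mem_singleton] at h3 h4
    omega

lemma dd_symm (n i j : ℕ) (hij : i < j) (hj : j < n) : dd n (n - j) (n - i) = dd n i j := by
  unfold dd
  rw [show n - i - (n - j) = j - i by omega, show n - (n - i) = i by omega]
  ring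

lemma coeff_symm (n M : ℕ) (hM : M ≤ 2 * n) : (A n 2).coeff M = (A n 2).coeff (2 * n - M) := by
  rw [coeff_A, coeff_A]
  congr 1
  refine Finset.sum_bij' (fun i _ => n - (M - i)) (fun i _ => n - (2 * n - M - i)) ?_ ?_ ?_ ?_ ?_
  · intro i hi
    simp only [Finset.mem_filter, Finset.mem_range] at hi ⊢
    omega
  · intro i hi
    simp only [Finset.mem_filter, Finset.mem_range] at hi ⊢
    omega
  · intro i hi
    simp only [Finset.mem_filter, Finset.mem_range] at hi ⊢
    omega
  · intro i hi
    simp only [Finset.mem_filter, Finset.mem_range] at hi ⊢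
    omega
  · intro i hi
    simp only [Finset.mem_filter, Finset.mem_range] at hi
    rw [← dd_symm n i (M - i) (by omega) (by omega)]
    congr 1
    omega

lemma coeff_zero (n M : ℕ) (hM : 2 * n < M) : (A n 2).coeff M = 0 := by
  rw [coeff_A, Finset.sum_eq_zero]
  · simp
  · intro i hi
    simp only [Finset.mem_filter, Finset.mem_range] at hi
    omega

lemma coeff_SS (n M : ℕ) (hM : M ≤ n) : (A n 2).coeff M = (SS n M : ℚ) := by
  rw [coeff_A]
  congr 1
  unfold SS
  apply Finset.sum_subset
  · intro i hi
    simp only [Finset.mem_filter, Finset.mem_range] at hi ⊢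
    omega
  · intro i hi hi2
    simp only [Finset.mem_filter, Finset.mem_range] at hi hi2
    have : i = 0 := by omega
    subst this
    unfold dd
    have := binF_compl n M (n - M + 1) (by omega)
    simp only [Nat.sub_zero, zero_add, binF_one]
    linarith

lemma coeff_mono (n a b : ℕ) (hab : a ≤ b) : b ≤ n → (A n 2).coeff a ≤ (A n 2).coeff b := by
  induction b, hab using Nat.le_induction with
  | base => intro _; exact le_rfl
  | succ b hb ih =>
    intro h
    refine (ih (by omega)).trans ?_
    rw [coeff_SS n b (by omega), coeff_SS n (b + 1) h]
    exact_mod_cast SS_step n b h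

lemma coeff_nonneg (n M : ℕ) : 0 ≤ (A n 2).coeff M := by
  unfold A
  rw [Polynomial.finset_sum_coeff]
  apply Finset.sum_nonneg
  intro σ _
  rw [Polynomial.coeff_X_pow]
  split_ifs <;> norm_num

/-- The major-index generating polynomial of 321-avoiding permutations of length `n` with
exactly 2 descents is symmetric (about degree `n·2/2 = n`, i.e. center `2n` overall) and
unimodal. -/
theorem A_two_descents_symmetric_unimodal (n : ℕ) :
    ((∀ M : ℕ, M ≤ 2 * n → (A n 2).coeff M = (A n 2).coeff (2 * n - M)) ∧
        ∀ M : ℕ, 2 * n < M → (A n 2).coeff M = 0) ∧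
      PolyUnimodal (A n 2) := by
  refine ⟨⟨coeff_symm n, coeff_zero n⟩, n, fun a b hab hb => coeff_mono n a b hab hb, ?_⟩
  intro a b ha hab
  by_cases hb : 2 * n < b
  · rw [coeff_zero n b hb]
    exact coeff_nonneg n a
  · rw [coeff_symm n a (by omega), coeff_symm n b (by omega)]
    exact coeff_mono n _ _ (by omega) (by omega)
end

section
/- For n ≥ 2k ≥ 4, the generating function by major index of standard Young tableaux of shape (n-k,k) with exactly 2 descents equals q^{k+2}·(1/(1+q))·(1+q+...+q^{k-2})·(1+q+...+q^{n-k-1})·(1+q+...+q^{n-2k}), and this polynomial is symmetric and unimodal with its coefficient sequence palindromic about degree n. -/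
open Finset Polynomial
open scoped Classical

lemma triple_sum_identity (k m : ℕ) (hk : 1 ≤ k) :
    (∑ b ∈ Finset.range (k - 1), ∑ t ∈ Finset.range (m + 1), ∑ a ∈ Finset.Ico (b + 1) (k + t),
      (X : ℚ[X]) ^ (a + (k + (b + 1) + t))) * (1 + X) =
      X ^ (k + 2) * (∑ j ∈ range (k - 1), X ^ j) * (∑ j ∈ range (k + m), X ^ j)
        * (∑ j ∈ range (m + 1), X ^ j) := by
  obtain ⟨r, rfl⟩ : ∃ r, k = r + 1 := ⟨k - 1, by omega⟩
  simp only [Nat.add_sub_cancel]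
  have hX1 : (X - 1 : ℚ[X]) ≠ 0 := X_sub_C_ne_zero (1 : ℚ)
  have hG : ∀ N : ℕ, (∑ j ∈ range N, (X : ℚ[X]) ^ j) * (X - 1) = X ^ N - 1 := fun N => geom_sum_mul X N
  have hG2 : ∀ N : ℕ, (∑ j ∈ range N, ((X : ℚ[X]) ^ 2) ^ j) * (X ^ 2 - 1) = (X ^ 2) ^ N - 1 :=
    fun N => geom_sum_mul (X ^ 2) N
  have h1 : (∑ b ∈ Finset.range r, ∑ t ∈ Finset.range (m + 1),
      ∑ a ∈ Finset.Ico (b + 1) (r + 1 + t), (X : ℚ[X]) ^ (a + (r + 1 + (b + 1) + t))) * (X - 1)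
      = X ^ (r + 1) * (X ^ (r + 2) * (∑ b ∈ range r, X ^ b) * (∑ t ∈ range (m + 1), (X ^ 2) ^ t)
        - X ^ 2 * (∑ b ∈ range r, (X ^ 2) ^ b) * (∑ t ∈ range (m + 1), X ^ t)) := by
    have h2 : ∀ b ∈ range r, ∀ t ∈ range (m + 1),
        (∑ a ∈ Finset.Ico (b + 1) (r + 1 + t), (X : ℚ[X]) ^ (a + (r + 1 + (b + 1) + t))) * (X - 1)
        = X ^ (r + 1) * (X ^ (r + 2) * (X ^ b * (X ^ 2) ^ t) - X ^ 2 * ((X ^ 2) ^ b * X ^ t)) := by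
      intro b hb t ht
      have hle : b + 1 ≤ r + 1 + t := by have := mem_range.1 hb; omega
      have h3 := geom_sum_Ico_mul (X : ℚ[X]) hle
      calc _ = X ^ (r + 1 + (b + 1) + t) * ((∑ a ∈ Finset.Ico (b + 1) (r + 1 + t), (X : ℚ[X]) ^ a) * (X - 1)) := by
            rw [← mul_assoc, mul_sum]
            congr 1
            apply sum_congr rfl
            intros; ring
        _ = _ := by rw [h3]; ring
    rw [sum_mul, sum_congr rfl (fun b hb => (sum_mul _ _ _).trans (sum_congr rfl (h2 b hb)))]
    rw [mul_assoc (X ^ (r + 2)), mul_assoc (X ^ 2), sum_mul_sum, sum_mul_sum]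
    simp only [mul_sum, mul_sub, sum_sub_distrib]
  apply mul_right_cancel₀ (mul_ne_zero (mul_ne_zero hX1 hX1) hX1)
  have e1 := hG r
  have e2 := hG (m+1)
  have e3 := hG (r+1+m)
  have e4 := hG2 r
  have e5 := hG2 (m+1)
  generalize (∑ b ∈ Finset.range r, ∑ t ∈ Finset.range (m + 1),
      ∑ a ∈ Finset.Ico (b + 1) (r + 1 + t), (X : ℚ[X]) ^ (a + (r + 1 + (b + 1) + t))) = S at *
  generalize (∑ j ∈ range r, (X : ℚ[X]) ^ j) = A at *
  generalize (∑ j ∈ range (m+1), (X : ℚ[X]) ^ j) = B at *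
  generalize (∑ j ∈ range (r+1+m), (X : ℚ[X]) ^ j) = C at *
  generalize (∑ j ∈ range r, ((X : ℚ[X])^2) ^ j) = D at *
  generalize (∑ j ∈ range (m+1), ((X : ℚ[X])^2) ^ j) = E at *
  calc S * (1 + X) * ((X - 1) * (X - 1) * (X - 1))
      = (S * (X - 1)) * ((X ^ 2 - 1) * (X - 1)) := by ring
    _ = X ^ (r + 1) * (X ^ (r + 2) * (A * (X - 1)) * (E * (X ^ 2 - 1))
          - X ^ 2 * (D * (X ^ 2 - 1)) * (B * (X - 1))) := by rw [h1]; ring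
    _ = X ^ (r + 1 + 2) * (A * (X - 1)) * (C * (X - 1)) * (B * (X - 1)) := by
        rw [e1, e2, e3, e4, e5]; ring
    _ = _ := by ring

lemma geom_coeff (N j : ℕ) : (∑ i ∈ range N, (X : ℚ[X]) ^ i).coeff j = if j < N then 1 else 0 := by
  simp [coeff_X_pow]

lemma geom_reflect (N : ℕ) : reflect N (∑ i ∈ range (N + 1), (X : ℚ[X]) ^ i)
    = ∑ i ∈ range (N + 1), (X : ℚ[X]) ^ i := by
  ext j
  rw [coeff_reflect, geom_coeff, geom_coeff]
  rcases le_or_gt j N with h | h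
  · rw [revAt_le h, if_pos (by omega), if_pos (by omega)]
  · rw [revAt_eq_self_of_lt h]

lemma geom_natDegree (N : ℕ) : (∑ i ∈ range (N + 1), (X : ℚ[X]) ^ i).natDegree ≤ N := by
  rw [natDegree_le_iff_coeff_eq_zero]
  intro j hj
  rw [geom_coeff, if_neg (by omega)]

/-- Coefficients of `[a][c]` (with shift recursion). -/
lemma geom_mul_coeff_zero (a c : ℕ) (ha : 1 ≤ a) (hc : 1 ≤ c) :
    ((∑ i ∈ range a, (X : ℚ[X]) ^ i) * (∑ i ∈ range c, (X : ℚ[X]) ^ i)).coeff 0 = 1 := by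
  rw [mul_coeff_zero, geom_coeff, geom_coeff, if_pos (by omega), if_pos (by omega), one_mul]

lemma geom_mul_coeff_succ (a c j : ℕ) :
    ((∑ i ∈ range a, (X : ℚ[X]) ^ i) * (∑ i ∈ range c, (X : ℚ[X]) ^ i)).coeff (j + 1) =
    ((∑ i ∈ range a, (X : ℚ[X]) ^ i) * (∑ i ∈ range c, (X : ℚ[X]) ^ i)).coeff j
      + (if j + 1 < a then 1 else 0) - (if c ≤ j + 1 ∧ j + 1 < a + c then 1 else 0) := by
  have h : ((∑ i ∈ range a, (X : ℚ[X]) ^ i) * (∑ i ∈ range c, (X : ℚ[X]) ^ i)) * (X - 1)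
      = (∑ i ∈ range a, (X : ℚ[X]) ^ i) * X ^ c - (∑ i ∈ range a, (X : ℚ[X]) ^ i) := by
    rw [mul_assoc, geom_sum_mul]; ring
  have h2 := congrArg (fun p => p.coeff (j + 1)) h
  simp only [mul_sub, mul_one, coeff_sub, coeff_mul_X, coeff_mul_X_pow', geom_coeff] at h2
  have h3 : (if c ≤ j + 1 then (if j + 1 - c < a then (1:ℚ) else 0) else 0)
    = if c ≤ j + 1 ∧ j + 1 < a + c then 1 else 0 := by
    split_ifs <;> first | rfl | omega
  rw [h3] at h2
  linarith

lemma geom_mul_coeff (a c : ℕ) (ha : 1 ≤ a) (hac : a ≤ c) (j : ℕ) (hj : j + 1 < a + c) :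
    ((∑ i ∈ range a, (X : ℚ[X]) ^ i) * (∑ i ∈ range c, (X : ℚ[X]) ^ i)).coeff j
    = ((if j < a then (j : ℤ) + 1 else if j < c then (a : ℤ) else a + c - 1 - j : ℤ) : ℚ) := by
  induction j with
  | zero => rw [geom_mul_coeff_zero a c ha (by omega), if_pos (by omega)]; simp
  | succ j ih =>
    rw [geom_mul_coeff_succ, ih (by omega)]
    have : ∀ (P : Prop) [Decidable P], (if P then (1 : ℚ) else 0) = ((if P then (1:ℤ) else 0 : ℤ) : ℚ) := by
      intro P _; split_ifs <;> simp
    rw [this, this, ← Int.cast_add, ← Int.cast_sub]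
    congr 1
    push_cast
    split_ifs <;> omega

/-- the alternating partial sums of the trapezoid sequence stay nonnegative -/
lemma alt_nonneg (a c : ℕ) (ha : 1 ≤ a) (hac : a ≤ c) (D : ℕ → ℚ)
    (h0 : D 0 = 1)
    (hs : ∀ j, j + 2 < a + c → D (j + 1) + D j =
      ((∑ i ∈ range a, (X : ℚ[X]) ^ i) * (∑ i ∈ range c, (X : ℚ[X]) ^ i)).coeff (j + 1))
    (j : ℕ) (hj : j + 1 < a + c) : 0 ≤ D j := by
  have key : ∀ j : ℕ, j + 1 < a + c → ∃ d : ℤ, D j = d ∧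
      (j < a → (j : ℤ) + 1 ≤ 2 * d ∧ 2 * d ≤ j + 2) ∧
      (a ≤ j → j < c → (a : ℤ) - 1 ≤ 2 * d ∧ 2 * d ≤ a + 1) ∧
      (a ≤ j → c ≤ j → (a : ℤ) + c - 1 - j - 2 ≤ 2 * d ∧ 2 * d ≤ a + c - 1 - j + 1) := by
    intro j
    induction j with
    | zero => intro _; exact ⟨1, by simp [h0], by intro; norm_num, by omega, by omega⟩
    | succ j ih =>
      intro hj
      obtain ⟨d, hd, h1, h2, h3⟩ := ih (by omega)
      have := hs j (by omega)
      rw [geom_mul_coeff a c ha hac _ hj, hd] at this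
      refine ⟨(if j + 1 < a then ((j + 1 : ℕ) : ℤ) + 1 else if j + 1 < c then (a : ℤ) else a + c - 1 - (j + 1 : ℕ)) - d, ?_, ?_⟩
      · rw [Int.cast_sub, ← this]; ring
      · push_cast
        split_ifs <;> omega
  obtain ⟨d, hd, h1, h2, h3⟩ := key j hj
  rw [hd]
  have : 0 ≤ d := by omega
  exact_mod_cast this

lemma sym_unimodal (P : ℚ[X]) (k m : ℕ) (hk : 2 ≤ k)
    (h : P * (1 + X) = X ^ (k + 2) * (∑ j ∈ range (k - 1), X ^ j) * (∑ j ∈ range (k + m), X ^ j)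
        * (∑ j ∈ range (m + 1), X ^ j)) :
    (∀ j : ℕ, P.coeff (2 * k + m - j) = P.coeff (2 * k + m + j)) ∧ PolyUnimodal P := by
  obtain ⟨r, rfl⟩ : ∃ r, k = r + 2 := ⟨k - 2, by omega⟩
  have e1 : r + 2 - 1 = r + 1 := by omega
  have e2 : r + 2 + m = (r + m + 1) + 1 := by omega
  rw [e1, e2] at h
  set n := 2 * (r + 2) + m with hn
  have hX1 : (1 + X : ℚ[X]) ≠ 0 := by
    have := X_add_C_ne_zero (1 : ℚ)
    rwa [add_comm] at this
  have hdX1 : (1 + X : ℚ[X]).natDegree = 1 := by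
    have := natDegree_X_add_C (1 : ℚ)
    rwa [add_comm] at this
  have d1 : ((X : ℚ[X]) ^ (r + 2 + 2)).natDegree ≤ 2 * (r + 2 + 2) := by
    rw [natDegree_X_pow]; omega
  have d2 := (natDegree_mul_le_of_le d1 (geom_natDegree r))
  have d3 := (natDegree_mul_le_of_le d2 (geom_natDegree (r + m + 1)))
  have d4 := (natDegree_mul_le_of_le d3 (geom_natDegree m))
  have hdeg : P.natDegree ≤ 2 * n := by
    by_cases hP : P = 0
    · simp [hP]
    rw [← h, natDegree_mul hP hX1, hdX1] at d4
    omega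
  have hrefl : reflect (2 * n) P = P := by
    apply mul_right_cancel₀ hX1
    have hr : reflect 1 (1 + X : ℚ[X]) = 1 + X := by
      have := geom_reflect 1
      simpa [sum_range_succ] using this
    have := reflect_mul P (1 + X : ℚ[X]) hdeg hdX1.le
    rw [hr] at this
    rw [← this, h]
    have e3 : 2 * n + 1 = 2 * (r + 2 + 2) + r + (r + m + 1) + m := by omega
    rw [e3, reflect_mul _ _ d3 (geom_natDegree m), reflect_mul _ _ d2 (geom_natDegree _),
      reflect_mul _ _ d1 (geom_natDegree _), geom_reflect, geom_reflect, geom_reflect,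
      ]
    congr 3
    rw [reflect_monomial, revAt_le (by omega)]
    congr 1; omega
  have hcl : ∀ N, N < r + 2 + 2 → P.coeff N = 0 := by
    intro N
    induction N with
    | zero =>
      intro _
      have := congrArg (fun p => p.coeff 0) h
      simpa [mul_coeff_zero] using this
    | succ N ih =>
      intro hN
      have := congrArg (fun p => p.coeff (N + 1)) h
      simp only [mul_assoc, coeff_X_pow_mul'] at this
      rw [if_neg (by omega), mul_add, mul_one, coeff_add, coeff_mul_X, ih (by omega)] at this
      simpa using this
  have hsym : ∀ j, P.coeff (n - j) = P.coeff (n + j) := by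
    intro j
    rcases le_or_gt j n with hj | hj
    · conv_lhs => rw [← hrefl]
      rw [coeff_reflect, revAt_le (by omega)]
      congr 1; omega
    · rw [hcl _ (by omega), coeff_eq_zero_of_natDegree_lt (by omega)]
  refine ⟨hsym, ?_⟩
  -- main recursion
  have hrec : ∀ j, j + 2 < (r + 1) + (m + 1) + 1→ P.coeff (j + (r + 2 + 2)) - P.coeff (j + (r + 2)) =
      ((∑ i ∈ range (r + 1), (X : ℚ[X]) ^ i) * (∑ i ∈ range (m + 1), (X : ℚ[X]) ^ i)).coeff j := by
    intro j hj
    have h5 : P - P * X ^ 2 = ((∑ i ∈ range (r + 1), (X : ℚ[X]) ^ i) *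
        (∑ i ∈ range (m + 1), (X : ℚ[X]) ^ i)) * X ^ (r + 2 + 2) -
        ((∑ i ∈ range (r + 1), (X : ℚ[X]) ^ i) *
        (∑ i ∈ range (m + 1), (X : ℚ[X]) ^ i)) * X ^ (r + 2 + 2 + (r + m + 1 + 1)) := by
      have := geom_sum_mul (X : ℚ[X]) (r + m + 1 + 1)
      calc _ = - (P * (1 + X)) * (X - 1) := by ring
        _ = - (X ^ (r + 2 + 2) * (∑ j ∈ range (r + 1), X ^ j) * (∑ j ∈ range (m + 1), X ^ j) *
            ((∑ j ∈ range (r + m + 1 + 1), X ^ j) * (X - 1))) := by rw [h]; ring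
        _ = _ := by rw [this]; ring
    have h6 := congrArg (fun p => p.coeff (j + (r + 2 + 2))) h5
    simp only [coeff_sub, coeff_mul_X_pow] at h6
    rw [coeff_mul_X_pow', coeff_mul_X_pow', if_pos (by omega), if_neg (by omega), sub_zero] at h6
    rw [← h6]
    congr 2
  have hstep : ∀ j, j + 1 < (r + 1) + (m + 1) → 
      0 ≤ P.coeff (j + (r + 2 + 2)) - P.coeff (j + (r + 2 + 1)) := by
    have h0 : P.coeff (0 + (r + 2 + 2)) - P.coeff (0 + (r + 2 + 1)) = 1 := by
      have := hrec 0 (by omega)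
      rw [geom_mul_coeff_zero _ _ (by omega) (by omega), hcl (0 + (r + 2)) (by omega)] at this
      rw [hcl (0 + (r + 2 + 1)) (by omega), this]
    have hs : ∀ j, j + 2 < (r + 1) + (m + 1) →
      (P.coeff (j + 1 + (r + 2 + 2)) - P.coeff (j + 1 + (r + 2 + 1))) +
      (P.coeff (j + (r + 2 + 2)) - P.coeff (j + (r + 2 + 1))) =
      ((∑ i ∈ range (r + 1), (X : ℚ[X]) ^ i) * (∑ i ∈ range (m + 1), (X : ℚ[X]) ^ i)).coeff (j + 1) := by
      intro j hj
      rw [← hrec (j + 1) (by omega)]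
      have e5 : j + 1 + (r + 2 + 1) = j + (r + 2 + 2) := by omega
      have e6 : j + 1 + (r + 2) = j + (r + 2 + 1) := by omega
      rw [e5, e6]; ring
    rcases le_total r m with hrm | hrm
    · exact alt_nonneg (r + 1) (m + 1) (by omega) (by omega)
        (fun j => P.coeff (j + (r + 2 + 2)) - P.coeff (j + (r + 2 + 1))) h0 hs
    · intro j hj
      exact alt_nonneg (m + 1) (r + 1) (by omega) (by omega)
        (fun j => P.coeff (j + (r + 2 + 2)) - P.coeff (j + (r + 2 + 1))) h0
        (fun j hj => by rw [hs j (by omega), mul_comm]) j (by omega)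
  have hmono : ∀ a b : ℕ, a ≤ b → b ≤ n → P.coeff a ≤ P.coeff b := by
    intro a b hab
    induction b, hab using Nat.le_induction with
    | base => intro _; exact le_rfl
    | succ b hab ih =>
      intro hb
      refine (ih (by omega)).trans ?_
      rcases lt_or_ge b (r + 3) with hb' | hb'
      · rw [hcl b (by omega), hcl (b + 1) (by omega)]
      · obtain ⟨j, rfl⟩ : ∃ j, b = j + (r + 2 + 1) := ⟨b - (r + 2 + 1), by omega⟩
        have := hstep j (by omega)
        have e7 : j + (r + 2 + 1) + 1 = j + (r + 2 + 2) := by omega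
        rw [e7]; linarith
  refine ⟨n, hmono, ?_⟩
  intro a b hna hab
  have ea := hsym (a - n)
  have eb := hsym (b - n)
  rw [show n + (a - n) = a by omega] at ea
  rw [show n + (b - n) = b by omega] at eb
  rw [← ea, ← eb]
  exact hmono _ _ (by omega) (by omega)

lemma mem_sytSet (n b : ℕ) (S : Finset ℕ) : S ∈ sytSet n b ↔ S ⊆ Icc 1 n ∧ S.card = b ∧
    ∀ m ∈ Icc 1 n, 2 * (S ∩ Icc 1 m).card ≤ m := by
  unfold sytSet
  simp only [mem_filter, mem_powerset]

/-- The second row made of two runs, of length `b` after `a` and of length `d` after `c`. -/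
def twoRuns (a b c d : ℕ) : Finset ℕ := Icc (a + 1) (a + b) ∪ Icc (c + 1) (c + d)

lemma mem_twoRuns (a b c d x : ℕ) : x ∈ twoRuns a b c d ↔
    (a + 1 ≤ x ∧ x ≤ a + b) ∨ (c + 1 ≤ x ∧ x ≤ c + d) := by
  simp [twoRuns]

lemma twoRuns_des (n a b c d : ℕ) (hb : 1 ≤ b) (hd : 1 ≤ d) (ha : b ≤ a) (hc : a + b < c)
    (hn : c + d ≤ n) : tabDes n (twoRuns a b c d) = {a, c} := by
  ext x
  simp only [tabDes, mem_filter, mem_Icc, mem_twoRuns, mem_insert, mem_singleton]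
  omega

lemma twoRuns_card (a b c d : ℕ) (hc : a + b < c) : (twoRuns a b c d).card = b + d := by
  unfold twoRuns
  rw [card_union_of_disjoint, Nat.card_Icc, Nat.card_Icc]
  · omega
  · rw [disjoint_left]
    intro x
    simp only [mem_Icc]
    omega

lemma twoRuns_ballot (a b c d m : ℕ) (ha : b ≤ a)
    (hc : a + b < c) (h2 : 2 * (b + d) ≤ c + d) :
    2 * (twoRuns a b c d ∩ Icc 1 m).card ≤ m := by
  have hsub : twoRuns a b c d ∩ Icc 1 m ⊆
      Icc (a + 1) (min (a + b) m) ∪ Icc (c + 1) (min (c + d) m) := by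
    intro x
    simp only [mem_inter, mem_twoRuns, mem_union, mem_Icc]
    omega
  have h := (card_le_card hsub).trans (card_union_le _ _)
  rw [Nat.card_Icc, Nat.card_Icc] at h
  omega

lemma twoRuns_mem (n k a b c : ℕ) (hb : 1 ≤ b) (hbk : b < k) (ha : b ≤ a) (hc : a + b < c)
    (h2 : k + b ≤ c) (hn : c + k ≤ n + b) :
    twoRuns a b c (k - b) ∈ (sytSet n k).filter (fun S => (tabDes n S).card = 2) := by
  rw [mem_filter, twoRuns_des n a b c (k - b) hb (by omega) ha hc (by omega)]
  refine ⟨?_, card_pair (by omega)⟩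
  rw [mem_sytSet, twoRuns_card _ _ _ _ hc]
  refine ⟨?_, by omega, fun m _ => twoRuns_ballot _ _ _ _ _ ha hc (by omega)⟩
  intro x
  rw [mem_twoRuns, mem_Icc]
  omega

lemma run_eq (T : Finset ℕ) (a : ℕ) (h0 : ∀ x ∈ T, a < x)
    (hdown : ∀ x, a < x → x + 1 ∈ T → x ∈ T) : T = Icc (a + 1) (a + T.card) := by
  have hd : ∀ y x, a < x → x ≤ y → y ∈ T → x ∈ T := by
    intro y x hx hxy
    induction y, hxy using Nat.le_induction with
    | base => exact id
    | succ y hy ih => intro h; exact ih (hdown y (by omega) h)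
  have hsub : T ⊆ Icc (a + 1) (a + T.card) := by
    intro y hy
    have : Icc (a + 1) y ⊆ T := by
      intro x hx
      rw [mem_Icc] at hx
      exact hd y x (by omega) hx.2 hy
    have h1 := card_le_card this
    rw [Nat.card_Icc] at h1
    have := h0 y hy
    rw [mem_Icc]; omega
  apply eq_of_subset_of_card_le hsub
  rw [Nat.card_Icc]; omega

lemma exists_twoRuns (n k : ℕ) (S : Finset ℕ)
    (hS : S ∈ (sytSet n k).filter (fun S => (tabDes n S).card = 2)) :
    ∃ a b c, 1 ≤ b ∧ b < k ∧ b ≤ a ∧ a + b < c ∧ k + b ≤ c ∧ c + k ≤ n + b ∧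
      twoRuns a b c (k - b) = S := by
  rw [mem_filter, mem_sytSet] at hS
  obtain ⟨⟨hSn, hcard, hbal⟩, hdes⟩ := hS
  obtain ⟨a, c, hac, hD⟩ : ∃ a c, a < c ∧ tabDes n S = {a, c} := by
    obtain ⟨x, y, hxy, h⟩ := card_eq_two.1 hdes
    rcases lt_or_gt_of_ne hxy with h1 | h1
    · exact ⟨x, y, h1, h⟩
    · exact ⟨y, x, h1, by rw [h, pair_comm]⟩
  have hSr : ∀ x ∈ S, 1 ≤ x ∧ x ≤ n := fun x hx => mem_Icc.1 (hSn hx)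
  have hmem : ∀ x, (1 ≤ x ∧ x ≤ n) ∧ (x + 1 ∈ S ∧ x ∉ S) ↔ x = a ∨ x = c := by
    intro x
    have : x ∈ tabDes n S ↔ x ∈ ({a, c} : Finset ℕ) := by rw [hD]
    simpa [tabDes] using this
  obtain ⟨⟨ha1, han⟩, ha2, ha3⟩ := (hmem a).2 (Or.inl rfl)
  obtain ⟨⟨hc1, hcn⟩, hc2, hc3⟩ := (hmem c).2 (Or.inr rfl)
  have h1S : 1 ∉ S := by
    intro h
    have hb := hbal 1 (mem_Icc.2 ⟨le_rfl, by omega⟩)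
    have : 0 < (S ∩ Icc 1 1).card := card_pos.2 ⟨1, by simp [h]⟩
    omega
  have hdn : ∀ x, 1 ≤ x → x ≠ a → x ≠ c → x + 1 ∈ S → x ∈ S := by
    intro x hx hxa hxc h
    by_contra hcon
    have := (hmem x).1 ⟨⟨hx, by have := hSr _ h; omega⟩, h, hcon⟩
    omega
  have hlow : ∀ x, x ≤ a → x ∉ S := by
    intro x
    induction x with
    | zero => intro _ h; have := hSr _ h; omega
    | succ x ih =>
      intro hx h
      rcases Nat.eq_zero_or_pos x with h0 | h0
      · subst h0; exact h1S h
      · exact ih (by omega) (hdn x h0 (by omega) (by omega) h)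
  have hT1 := run_eq (S.filter (fun x => x ≤ c)) a
    (by
      intro x hx
      rw [mem_filter] at hx
      by_contra hcon
      exact hlow x (by omega) hx.1)
    (by
      intro x hx h
      rw [mem_filter] at h ⊢
      exact ⟨hdn x (by omega) (by omega) (by omega) h.1, by omega⟩)
  have hT2 := run_eq (S.filter (fun x => ¬ x ≤ c)) c
    (by
      intro x hx
      rw [mem_filter] at hx
      omega)
    (by
      intro x hx h
      rw [mem_filter] at h ⊢
      exact ⟨hdn x (by omega) (by omega) (by omega) h.1, by omega⟩)
  have hsum := card_filter_add_card_filter_not (s := S) (fun x => x ≤ c)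
  generalize hb : (S.filter (fun x => x ≤ c)).card = b at *
  generalize hd : (S.filter (fun x => ¬ x ≤ c)).card = d at *
  have m1 : ∀ x, (x ∈ S ∧ x ≤ c) ↔ (a + 1 ≤ x ∧ x ≤ a + b) := by
    intro x; rw [← mem_Icc, ← hT1, mem_filter]
  have m2 : ∀ x, (x ∈ S ∧ ¬ x ≤ c) ↔ (c + 1 ≤ x ∧ x ≤ c + d) := by
    intro x; rw [← mem_Icc, ← hT2, mem_filter]
  have hb1 : 1 ≤ b := by have := (m1 (a + 1)).1 ⟨ha2, by omega⟩; omega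
  have hd1 : 1 ≤ d := by have := (m2 (c + 1)).1 ⟨hc2, by omega⟩; omega
  have hab : a + b < c := by
    by_contra hcon
    exact hc3 ((m1 c).2 ⟨by omega, by omega⟩).1
  have hcd : c + d ≤ n := (hSr _ ((m2 (c + d)).2 ⟨by omega, by omega⟩).1).2
  have hkd : k - b = d := by omega
  have hba : b ≤ a := by
    have h := hbal (a + b) (mem_Icc.2 ⟨by omega, by omega⟩)
    have hs : Icc (a + 1) (a + b) ⊆ S ∩ Icc 1 (a + b) := by
      intro x hx
      have hx' := mem_Icc.1 hx
      exact mem_inter.2 ⟨((m1 x).2 hx').1, mem_Icc.2 ⟨by omega, hx'.2⟩⟩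
    have := card_le_card hs
    rw [Nat.card_Icc] at this
    omega
  have hSeq : twoRuns a b c d = S := by
    ext x
    rw [mem_twoRuns, ← m1, ← m2]
    tauto
  have hkc : 2 * k ≤ c + d := by
    have h := hbal (c + d) (mem_Icc.2 ⟨by omega, hcd⟩)
    have hs : S ⊆ S ∩ Icc 1 (c + d) := by
      intro x hx
      have h1 := hx
      rw [← hSeq, mem_twoRuns] at h1
      exact mem_inter.2 ⟨hx, mem_Icc.2 (by omega)⟩
    have := card_le_card hs
    omega
  exact ⟨a, b, c, hb1, by omega, hba, hab, by omega, by omega, by rw [hkd, hSeq]⟩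

lemma twoRuns_inj (k a b c a' b' c' : ℕ) (n : ℕ) (hb : 1 ≤ b) (hbk : b < k) (ha : b ≤ a)
    (hc : a + b < c) (hn : c + k ≤ n + b)
    (hb' : 1 ≤ b') (hbk' : b' < k) (ha' : b' ≤ a') (hc' : a' + b' < c') (hn' : c' + k ≤ n + b')
    (h : twoRuns a b c (k - b) = twoRuns a' b' c' (k - b')) : a = a' ∧ b = b' ∧ c = c' := by
  have hD : ({a, c} : Finset ℕ) = {a', c'} := by
    rw [← twoRuns_des n a b c (k - b) hb (by omega) ha hc (by omega), h,
      twoRuns_des n a' b' c' (k - b') hb' (by omega) ha' hc' (by omega)]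
  have hm : ∀ x, (x = a ∨ x = c) ↔ (x = a' ∨ x = c') := by
    intro x
    have : x ∈ ({a, c} : Finset ℕ) ↔ x ∈ ({a', c'} : Finset ℕ) := by rw [hD]
    simpa using this
  have h1 := hm a
  have h2 := hm c
  have h3 := hm a'
  have h4 := hm c'
  have hM : ∀ x, ((a + 1 ≤ x ∧ x ≤ a + b) ∨ (c + 1 ≤ x ∧ x ≤ c + (k - b))) ↔
      ((a' + 1 ≤ x ∧ x ≤ a' + b') ∨ (c' + 1 ≤ x ∧ x ≤ c' + (k - b'))) := by
    intro x; rw [← mem_twoRuns, ← mem_twoRuns, h]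
  have haa : a = a' := by omega
  have hcc : c = c' := by omega
  subst haa hcc
  have h5 := hM (a + b)
  have h6 := hM (a + b')
  exact ⟨rfl, by omega, rfl⟩

lemma sytMajGF_eq_triple (k m : ℕ) : sytMajGF (k + m) k 2 =
    ∑ b ∈ Finset.range (k - 1), ∑ t ∈ Finset.range (m + 1), ∑ a ∈ Finset.Ico (b + 1) (k + t),
      (X : ℚ[X]) ^ (a + (k + (b + 1) + t)) := by
  rw [sytMajGF]
  have hstep : (∑ b ∈ Finset.range (k - 1), ∑ t ∈ Finset.range (m + 1),
      ∑ a ∈ Finset.Ico (b + 1) (k + t), (X : ℚ[X]) ^ (a + (k + (b + 1) + t))) =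
      ∑ p ∈ (Finset.range (k - 1) ×ˢ Finset.range (m + 1)).sigma
        (fun p => Finset.Ico (p.1 + 1) (k + p.2)), X ^ (p.2 + (k + (p.1.1 + 1) + p.1.2)) := by
    rw [sum_sigma, sum_product]
  rw [hstep]
  symm
  refine sum_bij (fun p _ => twoRuns p.2 (p.1.1 + 1) (k + (p.1.1 + 1) + p.1.2) (k - (p.1.1 + 1)))
    ?_ ?_ ?_ ?_
  · rintro ⟨⟨b, t⟩, a⟩ hp
    simp only [mem_sigma, mem_product, mem_range, mem_Ico] at hp
    dsimp only
    exact twoRuns_mem _ _ _ _ _ (by omega) (by omega) (by omega) (by omega) (by omega) (by omega)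
  · rintro ⟨⟨b, t⟩, a⟩ hp ⟨⟨b', t'⟩, a'⟩ hp' h
    simp only [mem_sigma, mem_product, mem_range, mem_Ico] at hp hp' h
    obtain ⟨h1, h2, h3⟩ := twoRuns_inj k _ _ _ _ _ _ (k + m + k) (by omega) (by omega) (by omega)
      (by omega) (by omega) (by omega) (by omega) (by omega) (by omega) (by omega) h
    have h4 : b = b' := by omega
    have h5 : t = t' := by omega
    subst h1 h4 h5
    rfl
  · intro S hS
    obtain ⟨a, b, c, h1, h2, h3, h4, h5, h6, h7⟩ := exists_twoRuns _ _ S hS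
    refine ⟨⟨⟨b - 1, c - k - b⟩, a⟩, ?_, ?_⟩
    · simp only [mem_sigma, mem_product, mem_range, mem_Ico]
      omega
    · dsimp only
      rw [show b - 1 + 1 = b by omega, show k + b + (c - k - b) = c by omega, h7]
  · rintro ⟨⟨b, t⟩, a⟩ hp
    simp only [mem_sigma, mem_product, mem_range, mem_Ico] at hp
    dsimp only
    rw [tabMaj, twoRuns_des _ _ _ _ _ (by omega) (by omega) (by omega) (by omega) (by omega),
      sum_pair (by omega)]
    rfl

/-- For `n ≥ 2k ≥ 4`, the major-index generating function for SYT of shape `(n-k,k)` with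
exactly 2 descents equals `q^{k+2}(1+q)⁻¹ [k-1]_q [n-k]_q [n-2k+1]_q` (stated multiplied
through by `1+q`), and it is symmetric about degree `n` and unimodal. -/
theorem sytMajGF_two_descents (n k : ℕ) (hk : 2 ≤ k) (hn : 2 * k ≤ n) :
    sytMajGF (n - k) k 2 * (1 + Polynomial.X) =
        Polynomial.X ^ (k + 2) * (∑ j ∈ Finset.range (k - 1), Polynomial.X ^ j)
          * (∑ j ∈ Finset.range (n - k), Polynomial.X ^ j)
          * (∑ j ∈ Finset.range (n - 2 * k + 1), Polynomial.X ^ j) ∧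
      (∀ j : ℕ, (sytMajGF (n - k) k 2).coeff (n - j) = (sytMajGF (n - k) k 2).coeff (n + j)) ∧
      PolyUnimodal (sytMajGF (n - k) k 2) := by
  obtain ⟨m, rfl⟩ : ∃ m, n = 2 * k + m := ⟨n - 2 * k, by omega⟩
  have e1 : 2 * k + m - k = k + m := by omega
  have e2 : 2 * k + m - 2 * k + 1 = m + 1 := by omega
  rw [e1, e2]
  have h := triple_sum_identity k m (by omega)
  rw [← sytMajGF_eq_triple] at h
  exact ⟨h, sym_unimodal _ k m hk h⟩
end

section
/- For n ≥ 5, the generating polynomial of the major index over 132-avoiding permutations of length n with exactly 2 descents is not unimodal: its coefficients of q^3, q^4, q^5 are C(n-1,2), C(n-1,2)-1, n²-4n+1 respectively, and n²-4n+1 > C(n-1,2)-1. -/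
open Finset Polynomial
open scoped Classical

/-- `∑ q^{maj σ}` over 132-avoiding permutations of length `n` with exactly 2 descents. -/
noncomputable def G132 (n : ℕ) : Polynomial ℚ :=
  (Finset.univ.filter
      (fun σ : Equiv.Perm (Fin n) => Avoids132 σ ∧ (permDes n σ).card = 2)).sum
    (fun σ => Polynomial.X ^ permMaj n σ)

/-- One-line notation as a function on naturals (0-based). -/
noncomputable def sv {n : ℕ} (σ : Equiv.Perm (Fin n)) (i : ℕ) : ℕ :=
  if h : i < n then (σ ⟨i, h⟩ : ℕ) else i

lemma sv_lt {n : ℕ} (σ : Equiv.Perm (Fin n)) {i : ℕ} (h : i < n) : sv σ i < n := by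
  simp [sv, h]

lemma sv_inj {n : ℕ} (σ : Equiv.Perm (Fin n)) {i j : ℕ} (hi : i < n) (hj : j < n)
    (h : sv σ i = sv σ j) : i = j := by
  simp only [sv, hi, hj, dif_pos] at h
  have := σ.injective (Fin.ext h)
  simpa using this

lemma sv_surj {n : ℕ} (σ : Equiv.Perm (Fin n)) {v : ℕ} (hv : v < n) :
    ∃ i, i < n ∧ sv σ i = v := by
  refine ⟨σ.symm ⟨v, hv⟩, (σ.symm ⟨v, hv⟩).2, ?_⟩
  simp [sv]

lemma mem_des {n : ℕ} (σ : Equiv.Perm (Fin n)) (i : ℕ) :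
    i ∈ permDes n σ ↔ 1 ≤ i ∧ i < n ∧ sv σ i < sv σ (i - 1) := by
  unfold permDes
  rw [Finset.mem_filter, Finset.mem_Ico]
  constructor
  · rintro ⟨⟨h1, h2⟩, h3⟩
    have h3 := h3 h2
    have h4 : i - 1 < n := by omega
    refine ⟨h1, h2, ?_⟩
    simp only [sv, h2, h4, dif_pos]
    exact h3
  · rintro ⟨h1, h2, h3⟩
    have h4 : i - 1 < n := by omega
    simp only [sv, h2, h4, dif_pos] at h3
    exact ⟨⟨h1, h2⟩, fun _ => h3⟩

lemma avoids_iff {n : ℕ} (σ : Equiv.Perm (Fin n)) :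
    Avoids132 σ ↔ ∀ i j k, i < j → j < k → k < n → sv σ i < sv σ k → sv σ k < sv σ j → False := by
  unfold Avoids132
  constructor
  · intro h i j k hij hjk hk h1 h2
    have hj : j < n := by omega
    have hi : i < n := by omega
    simp only [sv, hi, hj, hk, dif_pos] at h1 h2
    exact h ⟨⟨i, hi⟩, ⟨j, hj⟩, ⟨k, hk⟩, hij, hjk, h1, h2⟩
  · rintro h ⟨i, j, k, hij, hjk, h1, h2⟩
    apply h i j k hij hjk k.2
    · simpa [sv] using h1
    · simpa [sv] using h2

def TailInc {n : ℕ} (m : ℕ) (σ : Equiv.Perm (Fin n)) : Prop :=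
  ∀ i j, m ≤ i → i < j → j < n → sv σ i < sv σ j

/-- tail increasing if the descent set has no element beyond `m` -/
lemma tailInc_of_des {n m : ℕ} (σ : Equiv.Perm (Fin n))
    (h : ∀ i ∈ permDes n σ, i ≤ m) : TailInc m σ := by
  intro i j hi hij hj
  induction j, hij using Nat.le_induction with
  | base =>
    change sv σ i < sv σ (i+1)
    by_contra hc
    have hne : sv σ (i+1) ≠ sv σ i := fun e => by
      have := sv_inj σ hj (by omega) e
      omega
    have := h (i+1) ((mem_des σ _).2 ⟨by omega, hj, by simp; omega⟩)
    omega
  | succ j hij ih =>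
    have ih := ih (by omega)
    by_contra hc
    have hne : sv σ (j+1) ≠ sv σ j := fun e => by
      have := sv_inj σ hj (by omega) e
      omega
    have := h (j+1) ((mem_des σ _).2 ⟨by omega, hj, by simp; omega⟩)
    omega

lemma exists_perm (m k : ℕ) (f : Fin m → Fin (m + k)) (hf : Function.Injective f) :
    ∃ σ : Equiv.Perm (Fin (m + k)), (∀ i : Fin m, σ (Fin.castAdd k i) = f i) ∧
      TailInc m σ := by
  have hc : ((Finset.univ.image f)ᶜ).card = k := by
    rw [Finset.card_compl, Finset.card_image_of_injective _ hf]; simp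
  let e := ((Finset.univ.image f)ᶜ).orderEmbOfFin hc
  have he : ∀ j i, e j ≠ f i := by
    intro j i h
    have := Finset.orderEmbOfFin_mem _ hc j
    rw [Finset.mem_compl] at this
    exact this (Finset.mem_image.2 ⟨i, Finset.mem_univ _, h.symm⟩)
  let g : Fin (m + k) → Fin (m + k) := Fin.addCases f e
  have hg : Function.Injective g := by
    intro x y
    refine Fin.addCases (fun i => ?_) (fun i => ?_) x <;>
    refine Fin.addCases (fun j => ?_) (fun j => ?_) y <;> intro h <;>
    simp only [g, Fin.addCases_left, Fin.addCases_right] at h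
    · rw [hf h]
    · exact absurd h.symm (he _ _)
    · exact absurd h (he _ _)
    · rw [e.injective h]
  refine ⟨Equiv.ofBijective g (Finite.injective_iff_bijective.1 hg), ?_, ?_⟩
  · intro i; simp [g]
  · intro i j hi hij hj
    have hi' : i < m + k := by omega
    simp only [sv, hi', hj, dif_pos, Equiv.ofBijective_apply]
    have e1 : (⟨i, hi'⟩ : Fin (m+k)) = Fin.natAdd m ⟨i - m, by omega⟩ := by ext; simp; omega
    have e2 : (⟨j, hj⟩ : Fin (m+k)) = Fin.natAdd m ⟨j - m, by omega⟩ := by ext; simp; omega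
    rw [e1, e2]
    simp only [g, Fin.addCases_right]
    have : e ⟨i - m, by omega⟩ < e ⟨j - m, by omega⟩ := by
      rw [e.lt_iff_lt]
      change i - m < j - m
      omega
    exact this

lemma perm_unique {n m : ℕ} (σ τ : Equiv.Perm (Fin n))
    (hσ : TailInc m σ) (hτ : TailInc m τ) (h : ∀ i, i < m → i < n → sv σ i = sv τ i) : σ = τ := by
  have key : ∀ i, i < n → sv σ i = sv τ i := by
    intro i
    induction i using Nat.strong_induction_on with
    | _ i ih =>
      intro hi
      by_cases him : i < m
      · exact h i him hi
      obtain ⟨p, hp, hpe⟩ := sv_surj τ (sv_lt σ hi)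
      obtain ⟨q, hq, hqe⟩ := sv_surj σ (sv_lt τ hi)
      have hpi : ¬ p < i := fun hlt => by
        have := ih p hlt hp
        have := sv_inj σ hp hi (by omega)
        omega
      have hqi : ¬ q < i := fun hlt => by
        have := ih q hlt hq
        have := sv_inj τ hq hi (by omega)
        omega
      rcases Nat.eq_or_lt_of_not_lt hpi with e | e
      · subst e; exact hpe.symm
      rcases Nat.eq_or_lt_of_not_lt hqi with e' | e'
      · subst e'; exact hqe
      have := hτ i p (by omega) e hp
      have := hσ i q (by omega) e' hq
      omega
  ext i
  have := key i i.2
  simpa [sv] using this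

/-- Counting permutations with increasing tail by their prefixes, parametrised by `T`. -/
lemma card_param {ι : Type*} (m k : ℕ) (P : Equiv.Perm (Fin (m + k)) → Prop)
    (T : Finset ι) (F : ι → ℕ → ℕ)
    (hP : ∀ σ, P σ → TailInc m σ)
    (hlt : ∀ t ∈ T, ∀ i < m, F t i < m + k)
    (hinj : ∀ t ∈ T, ∀ i < m, ∀ j < m, F t i = F t j → i = j)
    (hF : ∀ t ∈ T, ∀ t' ∈ T, (∀ i < m, F t i = F t' i) → t = t')
    (h1 : ∀ σ, P σ → ∃ t ∈ T, ∀ i < m, sv σ i = F t i)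
    (h2 : ∀ σ, TailInc m σ → ∀ t ∈ T, (∀ i < m, sv σ i = F t i) → P σ) :
    (Finset.univ.filter P).card = T.card := by
  have hex : ∀ t, t ∈ T → ∃ σ : Equiv.Perm (Fin (m + k)), TailInc m σ ∧
      ∀ i < m, sv σ i = F t i := by
    intro t ht
    obtain ⟨σ, ha, hb⟩ := exists_perm m k (fun i => ⟨F t i, hlt t ht i i.2⟩) (by
      intro i j hij
      simp only [Fin.mk.injEq] at hij
      exact Fin.ext (hinj t ht i i.2 j j.2 hij))
    refine ⟨σ, hb, fun i hi => ?_⟩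
    have := ha ⟨i, hi⟩
    have h' : i < m + k := by omega
    simp only [sv, h', dif_pos]
    have e := congrArg Fin.val this
    simpa using e
  choose G hG1 hG2 using hex
  symm
  refine Finset.card_bij (fun t ht => G t ht) ?_ ?_ ?_
  · intro t ht
    exact Finset.mem_filter.2 ⟨Finset.mem_univ _, h2 _ (hG1 t ht) t ht (hG2 t ht)⟩
  · intro t ht t' ht' e
    apply hF t ht t' ht'
    intro i hi
    rw [← hG2 t ht i hi, ← hG2 t' ht' i hi, e]
  · intro σ hσ
    have hσ := (Finset.mem_filter.1 hσ).2
    obtain ⟨t, ht, h⟩ := h1 σ hσ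
    refine ⟨t, ht, perm_unique _ _ (hG1 t ht) (hP σ hσ) ?_⟩
    intro i hi _
    rw [hG2 t ht i hi, h i hi]

/-- pairs `j < i < N` -/
def Tri (N : ℕ) : Finset (Σ _ : ℕ, ℕ) := (Finset.range N).sigma (fun i => Finset.range i)

lemma mem_Tri {N : ℕ} {p : Σ _ : ℕ, ℕ} : p ∈ Tri N ↔ p.1 < N ∧ p.2 < p.1 := by
  simp [Tri]

lemma card_Tri (N : ℕ) : (Tri N).card = N.choose 2 := by
  simp [Tri, Finset.card_sigma, Finset.sum_range_id, Nat.choose_two_right]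

/-- Avoiding and descent set `{a,b}`. -/
def PP (n a b : ℕ) (σ : Equiv.Perm (Fin n)) : Prop :=
  Avoids132 σ ∧ permDes n σ = {a, b}

lemma PP_iff {n a b : ℕ} (σ : Equiv.Perm (Fin n)) :
    PP n a b σ ↔
    (∀ i j k, i < j → j < k → k < n → sv σ i < sv σ k → sv σ k < sv σ j → False) ∧
    (∀ i, (1 ≤ i ∧ i < n ∧ sv σ i < sv σ (i-1)) ↔ (i = a ∨ i = b)) := by
  unfold PP
  rw [avoids_iff, Finset.ext_iff]
  simp only [mem_des, Finset.mem_insert, Finset.mem_singleton]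

lemma PP_tail {n a b : ℕ} (hab : a < b) (σ : Equiv.Perm (Fin n)) (h : PP n a b σ) :
    TailInc b σ := by
  apply tailInc_of_des
  intro i hi
  rw [h.2] at hi
  simp at hi
  omega

/-- the position of a value which does not occur in the prefix -/
lemma zero_at {n m : ℕ} (hm : m < n) (σ : Equiv.Perm (Fin n)) (ht : TailInc m σ)
    (h : ∀ i < m, sv σ i ≠ 0) : sv σ m = 0 := by
  obtain ⟨p, hp, hpe⟩ := sv_surj σ (v := 0) (by omega)
  have h1 : ¬ p < m := fun hh => h p hh hpe
  rcases Nat.eq_or_lt_of_not_lt h1 with e | e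
  · subst e; exact hpe
  · have := ht m p le_rfl e hp
    omega

lemma val_pos {n m v : ℕ} (hv : v < n) (σ : Equiv.Perm (Fin n))
    (h : ∀ k, m ≤ k → k < n → sv σ k ≠ v) : ∃ p < m, sv σ p = v := by
  obtain ⟨p, hp, hpe⟩ := sv_surj σ hv
  by_cases hpm : p < m
  · exact ⟨p, hpm, hpe⟩
  · exact absurd hpe (h p (by omega) hp)

lemma sv_ne {n m : ℕ} (σ : Equiv.Perm (Fin n)) (i : ℕ) (hi : i < m) :
    ∀ k, m ≤ k → k < n → sv σ k ≠ sv σ i := by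
  intro k hk hkn e
  have := sv_inj σ hkn (by omega) e
  omega

lemma count12 (k : ℕ) : (Finset.univ.filter (PP (2 + (k+1)) 1 2)).card = (k+2).choose 2 := by
  rw [← card_Tri]
  apply card_param 2 (k+1) _ _
    (fun p i => match i with | 0 => p.1 + 1 | _ => p.2 + 1)
  · exact PP_tail (by omega)
  · intro t ht i hi
    rw [mem_Tri] at ht
    interval_cases i <;> simp <;> omega
  · intro t ht i hi j hj
    rw [mem_Tri] at ht
    interval_cases i <;> interval_cases j <;> simp <;> omega
  · rintro ⟨a, b⟩ ht ⟨a', b'⟩ ht' h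
    have h0 := h 0 (by omega)
    have h1 := h 1 (by omega)
    simp at h0 h1
    subst h0 h1; rfl
  · intro σ hσ
    have ht := PP_tail (by omega) σ hσ
    obtain ⟨hav, hd⟩ := (PP_iff σ).1 hσ
    have d1 := ((hd 1).2 (by omega)).2.2
    have d2 := ((hd 2).2 (by omega)).2.2
    have l0 := sv_lt σ (i := 0) (by omega)
    simp at d1 d2
    refine ⟨⟨sv σ 0 - 1, sv σ 1 - 1⟩, ?_, ?_⟩
    · rw [mem_Tri]; simp; omega
    · intro i hi
      interval_cases i <;> simp <;> omega
  · intro σ ht t htT h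
    rw [mem_Tri] at htT
    have h0 := h 0 (by omega)
    have h1 := h 1 (by omega)
    simp at h0 h1
    have hz := zero_at (by omega) σ ht (by intro i hi; interval_cases i <;> omega)
    rw [PP_iff]
    constructor
    · intro i j l hij hjl hl a1 a2
      by_cases hj : 2 ≤ j
      · have := ht j l hj hjl hl; omega
      · have : j = 1 := by omega
        have : i = 0 := by omega
        subst i j; omega
    · intro i
      constructor
      · rintro ⟨b1, b2, b3⟩
        by_contra hc
        have := ht (i-1) i (by omega) (by omega) b2
        omega
      · rintro (rfl | rfl) <;> simp <;> omega

lemma count13 (k : ℕ) : (Finset.univ.filter (PP (3 + (k+1)) 1 3)).card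
    = (k+2).choose 2 + (k+1) := by
  have hcard : ((Tri (k+2)).disjSum (Finset.range (k+1))).card = (k+2).choose 2 + (k+1) := by
    rw [Finset.card_disjSum, card_Tri, Finset.card_range]
  rw [← hcard]
  apply card_param 3 (k+1) _ _
    (fun t i => match t with
      | .inl p => (match i with | 0 => p.1 + 2 | 1 => p.2 + 1 | _ => p.2 + 2)
      | .inr a => (match i with | 0 => a + 2 | 1 => a + 1 | _ => a + 3))
  · exact PP_tail (by omega)
  · rintro (t | t) ht i hi
    · rw [Finset.inl_mem_disjSum, mem_Tri] at ht
      interval_cases i <;> simp <;> omega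
    · rw [Finset.inr_mem_disjSum, Finset.mem_range] at ht
      interval_cases i <;> simp <;> omega
  · rintro (t | t) ht i hi j hj
    · rw [Finset.inl_mem_disjSum, mem_Tri] at ht
      interval_cases i <;> interval_cases j <;> simp <;> omega
    · rw [Finset.inr_mem_disjSum, Finset.mem_range] at ht
      interval_cases i <;> interval_cases j <;> simp
  · rintro (⟨a, b⟩ | a) ht (⟨a', b'⟩ | a') ht' h <;>
    have h0 := h 0 (by omega) <;>
    have h1 := h 1 (by omega) <;>
    have h2 := h 2 (by omega) <;>
    simp at h0 h1 h2
    · subst h0 h1; rfl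
    · omega
    · omega
    · subst h0; rfl
  · intro σ hσ
    have ht := PP_tail (by omega) σ hσ
    obtain ⟨hav, hd⟩ := (PP_iff σ).1 hσ
    have d1 := ((hd 1).2 (by omega)).2.2
    have d2 : sv σ 1 ≤ sv σ 2 := by
      by_contra hc
      have := (hd 2).1 ⟨by omega, by omega, by simp; omega⟩
      omega
    have d3 := ((hd 3).2 (by omega)).2.2
    have l0 := sv_lt σ (i := 0) (by omega)
    have l2 := sv_lt σ (i := 2) (by omega)
    simp at d1 d3
    have n12 := sv_ne σ 1 (m := 2) (by omega) 2 (by omega) (by omega)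
    have n02 := sv_ne σ 0 (m := 2) (by omega) 2 (by omega) (by omega)
    have n13 := sv_ne σ 1 (m := 3) (by omega) 3 (by omega) (by omega)
    have a3 : sv σ 3 ≤ sv σ 1 ∨ sv σ 2 ≤ sv σ 3 := by
      by_contra hc
      exact hav 1 2 3 (by omega) (by omega) (by omega) (by omega) (by omega)
    have hbt : ∀ v, v ≤ sv σ 1 ∨ sv σ 2 ≤ v ∨ v = sv σ 0 := by
      intro v
      by_contra! hv
      obtain ⟨p, hp, hpe⟩ := val_pos (m := 3) (v := v) (by omega) σ (by
        intro l hl hln e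
        exact hav 1 2 l (by omega) (by omega) hln (by omega) (by omega))
      interval_cases p <;> omega
    have b1 := hbt (sv σ 1 + 1)
    have b2 := hbt (sv σ 1 + 2)
    by_cases hc : sv σ 2 = sv σ 1 + 1
    · refine ⟨.inl ⟨sv σ 0 - 2, sv σ 1 - 1⟩, ?_, ?_⟩
      · rw [Finset.inl_mem_disjSum, mem_Tri]; simp; omega
      · intro i hi
        interval_cases i <;> simp <;> omega
    · refine ⟨.inr (sv σ 1 - 1), ?_, ?_⟩
      · rw [Finset.inr_mem_disjSum, Finset.mem_range]; omega
      · intro i hi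
        interval_cases i <;> simp <;> omega
  · intro σ ht t htT h
    have h0 := h 0 (by omega)
    have h1 := h 1 (by omega)
    have h2 := h 2 (by omega)
    have key : 0 < sv σ 1 ∧ sv σ 1 < sv σ 0 ∧ (sv σ 2 = sv σ 1 + 1 ∨
        (sv σ 0 = sv σ 1 + 1 ∧ sv σ 2 = sv σ 1 + 2)) := by
      rcases t with t | t
      · rw [Finset.inl_mem_disjSum, mem_Tri] at htT
        simp at h0 h1 h2; omega
      · simp at h0 h1 h2; omega
    clear h0 h1 h2 h
    have hz := zero_at (by omega) σ ht (by intro i hi; interval_cases i <;> omega)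
    rw [PP_iff]
    constructor
    · intro i j l hij hjl hl a1 a2
      by_cases hj : 3 ≤ j
      · have := ht j l hj hjl hl; omega
      · have hj : j < 3 := by omega
        have hj1 : 1 ≤ j := by omega
        have c0 := sv_ne σ 0 (m := 1) (by omega) l (by omega) hl
        interval_cases j
        · have : i = 0 := by omega
          subst i; omega
        · interval_cases i <;> omega
    · intro i
      constructor
      · rintro ⟨b1, b2, b3⟩
        by_contra hc
        by_cases hi : i = 2
        · subst hi; simp at b3; omega
        have := ht (i-1) i (by omega) (by omega) b2
        omega
      · rintro (rfl | rfl) <;> simp <;> omega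

lemma count23 (k : ℕ) : (Finset.univ.filter (PP (3 + (k+1)) 2 3)).card
    = (k+2).choose 2 := by
  rw [← card_Tri]
  apply card_param 3 (k+1) _ _
    (fun p i => match i with | 0 => p.1 + 1 | 1 => p.1 + 2 | _ => p.2 + 1)
  · exact PP_tail (by omega)
  · intro t ht i hi
    rw [mem_Tri] at ht
    interval_cases i <;> simp <;> omega
  · intro t ht i hi j hj
    rw [mem_Tri] at ht
    interval_cases i <;> interval_cases j <;> simp <;> omega
  · rintro ⟨a, b⟩ ht ⟨a', b'⟩ ht' h
    have h0 := h 0 (by omega)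
    have h2 := h 2 (by omega)
    simp at h0 h2
    subst h0 h2; rfl
  · intro σ hσ
    have ht := PP_tail (by omega) σ hσ
    obtain ⟨hav, hd⟩ := (PP_iff σ).1 hσ
    have d1 : sv σ 0 ≤ sv σ 1 := by
      by_contra hc
      have := (hd 1).1 ⟨by omega, by omega, by simp; omega⟩
      omega
    have d2 := ((hd 2).2 (by omega)).2.2
    have d3 := ((hd 3).2 (by omega)).2.2
    have l1 := sv_lt σ (i := 1) (by omega)
    simp at d2 d3
    have n01 := sv_ne σ 0 (m := 1) (by omega) 1 (by omega) (by omega)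
    have n02 := sv_ne σ 0 (m := 1) (by omega) 2 (by omega) (by omega)
    have a2 : sv σ 2 ≤ sv σ 0 ∨ sv σ 1 ≤ sv σ 2 := by
      by_contra hc
      exact hav 0 1 2 (by omega) (by omega) (by omega) (by omega) (by omega)
    have hc : sv σ 1 = sv σ 0 + 1 := by
      by_contra hc
      obtain ⟨p, hp, hpe⟩ := val_pos (m := 2) (v := sv σ 0 + 1) (by omega) σ (by
        intro l hl hln e
        exact hav 0 1 l (by omega) (by omega) hln (by omega) (by omega))
      interval_cases p <;> omega
    refine ⟨⟨sv σ 0 - 1, sv σ 2 - 1⟩, ?_, ?_⟩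
    · rw [mem_Tri]; simp; omega
    · intro i hi
      interval_cases i <;> simp <;> omega
  · intro σ ht t htT h
    rw [mem_Tri] at htT
    have h0 := h 0 (by omega)
    have h1 := h 1 (by omega)
    have h2 := h 2 (by omega)
    simp at h0 h1 h2
    have hz := zero_at (by omega) σ ht (by intro i hi; interval_cases i <;> omega)
    rw [PP_iff]
    constructor
    · intro i j l hij hjl hl a1 a2
      by_cases hj : 3 ≤ j
      · have := ht j l hj hjl hl; omega
      · have hj : j < 3 := by omega
        have hj1 : 1 ≤ j := by omega
        interval_cases j <;> interval_cases i <;> omega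
    · intro i
      constructor
      · rintro ⟨b1, b2, b3⟩
        by_contra hc
        by_cases hi : i = 1
        · subst hi; simp at b3; omega
        have := ht (i-1) i (by omega) (by omega) b2
        omega
      · rintro (rfl | rfl) <;> simp <;> omega

lemma count14 (k : ℕ) : (Finset.univ.filter (PP (4 + (k+1)) 1 4)).card
    = (k+2).choose 2 + ((k+1) + (k+1)) := by
  have hcard : ((Tri (k+2)).disjSum ((Finset.range (k+1)).disjSum (Finset.range (k+1)))).card
      = (k+2).choose 2 + ((k+1) + (k+1)) := by
    rw [Finset.card_disjSum, Finset.card_disjSum, card_Tri, Finset.card_range]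
  rw [← hcard]
  apply card_param 4 (k+1) _ _
    (fun t i => match t with
      | .inl p => (match i with | 0 => p.1 + 3 | 1 => p.2 + 1 | 2 => p.2 + 2 | _ => p.2 + 3)
      | .inr (.inl a) => (match i with | 0 => a + 2 | 1 => a + 1 | 2 => a + 3 | _ => a + 4)
      | .inr (.inr a) => (match i with | 0 => a + 3 | 1 => a + 1 | 2 => a + 2 | _ => a + 4))
  · exact PP_tail (by omega)
  · rintro (t | t | t) ht i hi <;>
      simp only [Finset.inl_mem_disjSum, Finset.inr_mem_disjSum, mem_Tri, Finset.mem_range] at ht <;>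
      interval_cases i <;> simp <;> omega
  · rintro (t | t | t) ht i hi j hj <;>
      simp only [Finset.inl_mem_disjSum, Finset.inr_mem_disjSum, mem_Tri, Finset.mem_range] at ht <;>
      interval_cases i <;> interval_cases j <;> simp <;> omega
  · rintro (⟨a, b⟩ | a | a) ht (⟨a', b'⟩ | a' | a') ht' h <;>
    have h0 := h 0 (by omega) <;>
    have h1 := h 1 (by omega) <;>
    have h2 := h 2 (by omega) <;>
    have h3 := h 3 (by omega) <;>
    simp at h0 h1 h2 h3 <;> first | omega | (subst h0 h1; rfl) | (subst h0; rfl)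
  · intro σ hσ
    have ht := PP_tail (by omega) σ hσ
    obtain ⟨hav, hd⟩ := (PP_iff σ).1 hσ
    have d1 := ((hd 1).2 (by omega)).2.2
    have d2 : sv σ 1 ≤ sv σ 2 := by
      by_contra hc
      have := (hd 2).1 ⟨by omega, by omega, by simp; omega⟩
      omega
    have d3 : sv σ 2 ≤ sv σ 3 := by
      by_contra hc
      have := (hd 3).1 ⟨by omega, by omega, by simp; omega⟩
      omega
    have d4 := ((hd 4).2 (by omega)).2.2
    have l0 := sv_lt σ (i := 0) (by omega)
    have l3 := sv_lt σ (i := 3) (by omega)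
    simp at d1 d4
    have n12 := sv_ne σ 1 (m := 2) (by omega) 2 (by omega) (by omega)
    have n02 := sv_ne σ 0 (m := 2) (by omega) 2 (by omega) (by omega)
    have n03 := sv_ne σ 0 (m := 2) (by omega) 3 (by omega) (by omega)
    have n23 := sv_ne σ 2 (m := 3) (by omega) 3 (by omega) (by omega)
    have n14 := sv_ne σ 1 (m := 3) (by omega) 4 (by omega) (by omega)
    have a3 : sv σ 4 ≤ sv σ 1 ∨ sv σ 3 ≤ sv σ 4 := by
      by_contra hc
      exact hav 1 3 4 (by omega) (by omega) (by omega) (by omega) (by omega)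
    have hbt : ∀ v, v ≤ sv σ 1 ∨ sv σ 3 ≤ v ∨ v = sv σ 0 ∨ v = sv σ 2 := by
      intro v
      by_contra! hv
      obtain ⟨p, hp, hpe⟩ := val_pos (m := 4) (v := v) (by omega) σ (by
        intro l hl hln e
        exact hav 1 3 l (by omega) (by omega) hln (by omega) (by omega))
      interval_cases p <;> omega
    have b1 := hbt (sv σ 1 + 1)
    have b2 := hbt (sv σ 1 + 2)
    have b3 := hbt (sv σ 1 + 3)
    by_cases hc : sv σ 3 < sv σ 0
    · refine ⟨.inl ⟨sv σ 0 - 3, sv σ 1 - 1⟩, ?_, ?_⟩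
      · rw [Finset.inl_mem_disjSum, mem_Tri]; simp; omega
      · intro i hi
        interval_cases i <;> simp <;> omega
    by_cases hc2 : sv σ 0 < sv σ 2
    · refine ⟨.inr (.inl (sv σ 1 - 1)), ?_, ?_⟩
      · rw [Finset.inr_mem_disjSum, Finset.inl_mem_disjSum, Finset.mem_range]; omega
      · intro i hi
        interval_cases i <;> simp <;> omega
    · refine ⟨.inr (.inr (sv σ 1 - 1)), ?_, ?_⟩
      · rw [Finset.inr_mem_disjSum, Finset.inr_mem_disjSum, Finset.mem_range]; omega
      · intro i hi
        interval_cases i <;> simp <;> omega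
  · intro σ ht t htT h
    have h0 := h 0 (by omega)
    have h1 := h 1 (by omega)
    have h2 := h 2 (by omega)
    have h3 := h 3 (by omega)
    have key : 0 < sv σ 1 ∧ sv σ 1 < sv σ 0 ∧ sv σ 1 < sv σ 2 ∧ sv σ 2 < sv σ 3 ∧
        (sv σ 3 = sv σ 1 + 2 ∨ (sv σ 3 = sv σ 1 + 3 ∧ sv σ 0 < sv σ 3 ∧ sv σ 0 ≠ sv σ 2)) := by
      rcases t with t | t | t
      · rw [Finset.inl_mem_disjSum, mem_Tri] at htT
        simp at h0 h1 h2 h3; omega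
      · simp at h0 h1 h2 h3; omega
      · simp at h0 h1 h2 h3; omega
    clear h0 h1 h2 h3 h
    have hz := zero_at (by omega) σ ht (by intro i hi; interval_cases i <;> omega)
    rw [PP_iff]
    constructor
    · intro i j l hij hjl hl a1 a2
      by_cases hj : 4 ≤ j
      · have := ht j l hj hjl hl; omega
      · have hj : j < 4 := by omega
        have hj1 : 1 ≤ j := by omega
        have c0 := sv_ne σ 0 (m := 1) (by omega) l (by omega) hl
        interval_cases j
        · interval_cases i; omega
        · by_cases hl3 : l = 3
          · subst hl3; omega
          interval_cases i <;> have c2 := sv_ne σ 2 (m := 3) (by omega) l (by omega) hl <;> omega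
        · have c2 := sv_ne σ 2 (m := 3) (by omega) l (by omega) hl
          interval_cases i <;> omega
    · intro i
      constructor
      · rintro ⟨b1, b2, b3⟩
        by_contra hc
        by_cases hi : i = 2
        · subst hi; simp at b3; omega
        by_cases hi : i = 3
        · subst hi; simp at b3; omega
        have := ht (i-1) i (by omega) (by omega) b2
        omega
      · rintro (rfl | rfl) <;> simp <;> omega

lemma coeff_card (n d : ℕ) : (G132 n).coeff d =
    ((Finset.univ.filter (fun σ : Equiv.Perm (Fin n) =>
      (Avoids132 σ ∧ (permDes n σ).card = 2) ∧ permMaj n σ = d)).card : ℚ) := by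
  unfold G132
  rw [Polynomial.finsetSum_coeff]
  simp only [Polynomial.coeff_X_pow]
  rw [Finset.sum_boole, Finset.filter_filter]
  congr 2
  ext σ
  simp only [Finset.mem_filter, eq_comm]

lemma des_pair (n d : ℕ) (σ : Equiv.Perm (Fin n)) :
    ((permDes n σ).card = 2 ∧ permMaj n σ = d) ↔
      ∃ a b, 1 ≤ a ∧ a < b ∧ a + b = d ∧ permDes n σ = {a, b} := by
  unfold permMaj
  constructor
  · rintro ⟨h1, h2⟩
    obtain ⟨x, y, hxy, e⟩ := Finset.card_eq_two.1 h1
    have hx := ((mem_des σ x).1 (by rw [e]; simp)).1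
    have hy := ((mem_des σ y).1 (by rw [e]; simp)).1
    rw [e, Finset.sum_pair hxy] at h2
    simp only [id] at h2
    rcases lt_or_gt_of_ne hxy with h | h
    · exact ⟨x, y, hx, h, h2, e⟩
    · exact ⟨y, x, hy, h, by omega, by rw [e, Finset.pair_comm]⟩
  · rintro ⟨a, b, h1, h2, h3, e⟩
    rw [e, Finset.card_pair h2.ne, Finset.sum_pair h2.ne]
    exact ⟨rfl, h3⟩

lemma coeff3 (n : ℕ) : (G132 n).coeff 3 = ((Finset.univ.filter (PP n 1 2)).card : ℚ) := by
  rw [coeff_card]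
  congr 2
  ext σ
  simp only [Finset.mem_filter, Finset.mem_univ, true_and, and_assoc, des_pair, PP]
  refine and_congr_right fun _ => ⟨?_, fun h => ⟨1, 2, by omega, by omega, by omega, h⟩⟩
  rintro ⟨a, b, h1, h2, h3, e⟩
  have ha : a = 1 := by omega
  have hb : b = 2 := by omega
  rw [e, ha, hb]

lemma coeff4 (n : ℕ) : (G132 n).coeff 4 = ((Finset.univ.filter (PP n 1 3)).card : ℚ) := by
  rw [coeff_card]
  congr 2
  ext σ
  simp only [Finset.mem_filter, Finset.mem_univ, true_and, and_assoc, des_pair, PP]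
  refine and_congr_right fun _ => ⟨?_, fun h => ⟨1, 3, by omega, by omega, by omega, h⟩⟩
  rintro ⟨a, b, h1, h2, h3, e⟩
  have ha : a = 1 := by omega
  have hb : b = 3 := by omega
  rw [e, ha, hb]

lemma coeff5 (n : ℕ) : (G132 n).coeff 5 = (((Finset.univ.filter (PP n 2 3)).card +
    (Finset.univ.filter (PP n 1 4)).card : ℕ) : ℚ) := by
  rw [coeff_card, ← Finset.card_union_of_disjoint]
  · congr 2
    ext σ
    simp only [Finset.mem_filter, Finset.mem_union, Finset.mem_univ, true_and, and_assoc,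
      des_pair, PP, ← and_or_left]
    refine and_congr_right fun _ => ⟨?_, ?_⟩
    · rintro ⟨a, b, h1, h2, h3, e⟩
      have : (a = 2 ∧ b = 3) ∨ (a = 1 ∧ b = 4) := by omega
      rcases this with ⟨ha, hb⟩ | ⟨ha, hb⟩
      · left; rw [e, ha, hb]
      · right; rw [e, ha, hb]
    · rintro (h | h)
      · exact ⟨2, 3, by omega, by omega, by omega, h⟩
      · exact ⟨1, 4, by omega, by omega, by omega, h⟩
  · rw [Finset.disjoint_left]
    intro σ h1 h2
    have e1 := (Finset.mem_filter.1 h1).2.2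
    have e2 := (Finset.mem_filter.1 h2).2.2
    rw [e1] at e2
    exact absurd e2 (by decide)

/-- For `n ≥ 5`, the major-index generating polynomial of 132-avoiding permutations of
length `n` with exactly 2 descents is not unimodal: its coefficients at `q³, q⁴, q⁵` are
`C(n-1,2)`, `C(n-1,2) - 1`, `n² - 4n + 1`, and `n² - 4n + 1 > C(n-1,2) - 1`. -/
theorem G132_not_unimodal (n : ℕ) (hn : 5 ≤ n) :
    (G132 n).coeff 3 = (Nat.choose (n - 1) 2 : ℚ) ∧
      (G132 n).coeff 4 = ((Nat.choose (n - 1) 2 - 1 : ℕ) : ℚ) ∧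
      (G132 n).coeff 5 = ((n ^ 2 - 4 * n + 1 : ℕ) : ℚ) ∧
      n ^ 2 - 4 * n + 1 > Nat.choose (n - 1) 2 - 1 ∧
      ¬ PolyUnimodal (G132 n) := by
  obtain ⟨k, rfl⟩ : ∃ k, n = k + 5 := ⟨n - 5, by omega⟩
  have c12 := count12 (k+2)
  have c13 := count13 (k+1)
  have c23 := count23 (k+1)
  have c14 := count14 k
  rw [show 2 + (k+2+1) = k + 5 by ring] at c12
  rw [show 3 + (k+1+1) = k + 5 by ring] at c13 c23
  rw [show 4 + (k+1) = k + 5 by ring] at c14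
  have s2 : (k+2+1).choose 2 = (k+2) + (k+2).choose 2 := by
    rw [Nat.choose_succ_succ' (k+2) 1, Nat.choose_one_right]
  have s3 : (k+2+2).choose 2 = (k+3) + (k+2+1).choose 2 := by
    rw [Nat.choose_succ_succ' (k+3) 1, Nat.choose_one_right]
  have s1 : 2 * (k+2).choose 2 = (k+2) * (k+1) := by
    have := Nat.triangle_succ (k+1)
    rw [Nat.choose_two_right, Nat.mul_div_cancel']
    · rfl
    · exact (Nat.even_mul_pred_self (k+2)).two_dvd
  have e1 : k + 5 - 1 = k + 2 + 2 := by omega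
  have hp : (k+5)^2 - 4*(k+5) + 1 = k*k + 6*k + 6 := by
    have : (k+5)^2 = (k*k + 6*k + 5) + 4*(k+5) := by ring
    omega
  have s1' : 2 * (k+2).choose 2 = k*k + 3*k + 2 := by rw [s1]; ring
  have H3 : (G132 (k+5)).coeff 3 = (Nat.choose (k + 5 - 1) 2 : ℚ) := by
    rw [coeff3, c12, e1]
  have H4 : (G132 (k+5)).coeff 4 = ((Nat.choose (k + 5 - 1) 2 - 1 : ℕ) : ℚ) := by
    rw [coeff4, c13, e1]
    congr 1
    rw [show k + 1 + 2 = k + 2 + 1 by ring]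
    omega
  have H5 : (G132 (k+5)).coeff 5 = (((k+5) ^ 2 - 4 * (k+5) + 1 : ℕ) : ℚ) := by
    rw [coeff5, c23, c14, hp]
    congr 1
    rw [show k + 1 + 2 = k + 2 + 1 by ring]
    omega
  have H : (k+5) ^ 2 - 4 * (k+5) + 1 > Nat.choose (k + 5 - 1) 2 - 1 := by
    rw [hp, e1]; omega
  refine ⟨H3, H4, H5, H, ?_⟩
  rintro ⟨t, ha, hb⟩
  have p34 : (G132 (k+5)).coeff 4 < (G132 (k+5)).coeff 3 := by
    rw [H3, H4, e1]
    exact_mod_cast (by omega : Nat.choose (k+2+2) 2 - 1 < Nat.choose (k+2+2) 2)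
  have p45 : (G132 (k+5)).coeff 4 < (G132 (k+5)).coeff 5 := by
    rw [H4, H5]
    exact_mod_cast H
  rcases le_total 4 t with h | h
  · exact absurd (ha 3 4 (by omega) h) (not_le.2 p34)
  · exact absurd (hb 4 5 h (by omega)) (not_le.2 p45)
end
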